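/- arXiv:0909.5626 — 2 statements merged into one kernel-verified Lean document; each statement's English description precedes it below -/
import Mathlib

section
/- The solution of the model Riemann–Hilbert problem is unique: if M and M̃ are both solutions of the model Riemann–Hilbert problem (with the same data N, a_k, b_k, α_k, n), then M(z) = M̃(z) for every z ∈ ℂ \ [a_1, b_N]. -/
open Complex Filter Topology Asymptotics Bornology

noncomputable section

/-- The cut interval `[a₁, b_N]` viewed as a subset of the complex plane.
Here `a b : ℕ → ℝ` are 0-indexed, so `a 0 = a₁` and `b (N-1) = b_N`. -/
def cutSet (N : ℕ) (a b : ℕ → ℝ) : Set ℂ :=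
  Complex.ofReal '' Set.Icc (a 0) (b (N - 1))

/-- The diagonal jump matrix `diag(e^{-2πiθ}, e^{2πiθ})` on the gaps. -/
def gapJump (θ : ℝ) : Matrix (Fin 2) (Fin 2) ℂ :=
  !![Complex.exp (-(2 * Real.pi * θ) * Complex.I), 0;
     0, Complex.exp ((2 * Real.pi * θ) * Complex.I)]

/-- `M` is a solution of the model Riemann-Hilbert problem with data
`N`, endpoints `a 0 < b 0 < a 1 < b 1 < ⋯ < a (N-1) < b (N-1)`, and gap jump
parameters `β k` (the jump on the gap `(b k, a (k+1))` is `diag(e^{-2πiβₖ}, e^{2πiβₖ})`;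
for the model problem of the paper one takes `β k = n * α k`). The conditions:
(a) every entry of `M` is analytic on `ℂ \ [a₁, b_N]`;
(b) `M` has continuous boundary values `M₊` (from the upper half-plane) and `M₋`
(from the lower half-plane) on each open cut `(a k, b k)` and each open gap
`(b k, a (k+1))`, with `M₊ = M₋ * [[0,1],[-1,0]]` on the cuts and
`M₊ = M₋ * diag(e^{-2πiβₖ}, e^{2πiβₖ})` on the gaps;
(c) `M(z) = I + O(1/z)` as `z → ∞`;
(d) each entry of `M` is `O(|z - p|^{-1/4})` as `z → p` for each endpoint `p`. -/
def IsModelRHSolution (N : ℕ) (a b β : ℕ → ℝ)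
    (M : ℂ → Matrix (Fin 2) (Fin 2) ℂ) : Prop :=
  (∀ i j, AnalyticOnNhd ℂ (fun z => M z i j) (cutSet N a b)ᶜ) ∧
  (∀ k < N, ∀ x ∈ Set.Ioo (a k) (b k),
    ∃ Mp Mm : Matrix (Fin 2) (Fin 2) ℂ,
      Tendsto M (𝓝[{z : ℂ | 0 < z.im}] (x : ℂ)) (𝓝 Mp) ∧
      Tendsto M (𝓝[{z : ℂ | z.im < 0}] (x : ℂ)) (𝓝 Mm) ∧
      Mp = Mm * !![0, 1; -1, 0]) ∧
  (∀ k, k + 1 < N → ∀ x ∈ Set.Ioo (b k) (a (k + 1)),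
    ∃ Mp Mm : Matrix (Fin 2) (Fin 2) ℂ,
      Tendsto M (𝓝[{z : ℂ | 0 < z.im}] (x : ℂ)) (𝓝 Mp) ∧
      Tendsto M (𝓝[{z : ℂ | z.im < 0}] (x : ℂ)) (𝓝 Mm) ∧
      Mp = Mm * gapJump (β k)) ∧
  (∀ i j, (fun z : ℂ => M z i j - (1 : Matrix (Fin 2) (Fin 2) ℂ) i j)
      =O[Bornology.cobounded ℂ] fun z => z⁻¹) ∧
  (∀ k < N, ∀ p ∈ ({a k, b k} : Set ℝ), ∀ i j,
      (fun z => M z i j) =O[𝓝[(cutSet N a b)ᶜ] ((p : ℝ) : ℂ)]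
        fun z => ‖z - (p : ℂ)‖ ^ (-(1 / 4) : ℝ))

/-- Painlevé: continuous on the plane and holomorphic off the real line implies entire. -/
lemma entire_of_off_real (H : ℂ → ℂ) (hc : Continuous H)
    (hd : DifferentiableOn ℂ H {z : ℂ | z.im ≠ 0}) : Differentiable ℂ H := by
  have hopen : IsOpen {z : ℂ | z.im ≠ 0} := isOpen_ne_fun Complex.continuous_im continuous_const
  have hcons : Complex.IsConservativeOn H Set.univ := by
    intro z w _
    rw [← add_eq_zero_iff_eq_neg, Complex.wedgeIntegral_add_wedgeIntegral_eq]
    have key : ∀ u v : ℂ, (u.im = 0 ∨ v.im = 0) →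
        (∫ x : ℝ in u.re..v.re, H (x + u.im * I)) - (∫ x : ℝ in u.re..v.re, H (x + v.im * I)) +
        I • (∫ y : ℝ in u.im..v.im, H (v.re + y * I)) -
        I • (∫ y : ℝ in u.im..v.im, H (u.re + y * I)) = 0 := by
      intro u v huv
      apply Complex.integral_boundary_rect_eq_zero_of_continuousOn_of_differentiableOn H u v
        hc.continuousOn
      apply hd.mono
      intro t ht h0
      have h2 := ht.2
      simp only [Set.mem_preimage, Set.mem_Ioo] at h2
      rw [h0] at h2
      rcases huv with h | h <;> rw [h] at h2 <;> grind
    have k1 := key z (w.re : ℂ) (Or.inr (by simp))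
    have k2 := key (z.re : ℂ) w (Or.inl (by simp))
    simp only [ofReal_re, ofReal_im] at k1 k2
    have ii : ∀ c : ℝ, ∀ p q : ℝ,
        IntervalIntegrable (fun y : ℝ => H (c + y * I)) MeasureTheory.volume p q := by
      intro c p q
      apply Continuous.intervalIntegrable
      fun_prop
    rw [← intervalIntegral.integral_add_adjacent_intervals (ii w.re z.im 0) (ii w.re 0 w.im),
      ← intervalIntegral.integral_add_adjacent_intervals (ii z.re z.im 0) (ii z.re 0 w.im)]
    simp only [smul_eq_mul] at *
    linear_combination k1 + k2
  exact differentiableOn_univ.1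
    ((Complex.isConservativeOn_and_continuousOn_iff_isDifferentiableOn isOpen_univ).1
      ⟨hcons, hc.continuousOn⟩)

lemma entire_factor (S : Finset ℂ) : ∀ (H : ℂ → ℂ), Differentiable ℂ H → (∀ p ∈ S, H p = 0) →
    ∃ K : ℂ → ℂ, Differentiable ℂ K ∧ ∀ z, H z = (∏ p ∈ S, (z - p)) * K z := by
  classical
  induction S using Finset.induction_on with
  | empty => intro H hH _; exact ⟨H, hH, by simp⟩
  | insert p S hp ih =>
    intro H hH h0
    have hpz : H p = 0 := h0 p (by simp)
    have hK1 : Differentiable ℂ (dslope H p) := by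
      have := (Complex.differentiableOn_dslope (f := H) (c := p) (s := Set.univ)
        Filter.univ_mem).2 hH.differentiableOn
      exact differentiableOn_univ.1 this
    have hmul : ∀ z, H z = (z - p) * dslope H p z := by
      intro z
      have := sub_smul_dslope H p z
      rw [hpz, sub_zero, smul_eq_mul] at this
      exact this.symm
    obtain ⟨K, hK, hKe⟩ := ih (dslope H p) hK1 (by
      intro q hq
      have h1 := h0 q (by simp [hq])
      rw [hmul q] at h1
      rcases mul_eq_zero.1 h1 with h | h
      · exact absurd (sub_eq_zero.1 h ▸ hq) hp
      · exact h)
    refine ⟨K, hK, fun z => ?_⟩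
    rw [hmul z, hKe z, Finset.prod_insert hp, mul_assoc]

lemma dense_im_ne : Dense {z : ℂ | z.im ≠ 0} := by
  have := (dense_compl_singleton (0 : ℝ)).preimage Complex.isOpenMap_im
  exact this

lemma key_const (C : Set ℂ) (hC : IsCompact C) (hCr : ∀ z ∈ C, z.im = 0) (S : Finset ℂ)
    (f : ℂ → ℂ) (L : ℂ) (hf : DifferentiableOn ℂ f Cᶜ)
    (hlim : ∀ z ∈ C, z ∉ S → ∃ y, Tendsto f (𝓝[{z : ℂ | z.im ≠ 0}] z) (𝓝 y))
    (hS : ∀ p ∈ S, Tendsto (fun z => (z - p) * f z) (𝓝[{z : ℂ | z.im ≠ 0}] p) (𝓝 0))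
    (hinf : Tendsto f (cobounded ℂ) (𝓝 L)) : ∀ z ∈ Cᶜ, f z = L := by
  classical
  set A : Set ℂ := {z : ℂ | z.im ≠ 0} with hA
  have hAo : IsOpen A := isOpen_ne_fun Complex.continuous_im continuous_const
  have hAd : Dense A := dense_im_ne
  have hAC : A ⊆ Cᶜ := fun z hz hzC => hz (hCr z hzC)
  have hCo : IsOpen Cᶜ := hC.isClosed.isOpen_compl
  set P : ℂ → ℂ := fun z => ∏ p ∈ S, (z - p) with hP
  have hPc : Differentiable ℂ P := by
    rw [hP]; fun_prop
  have hfc : ∀ z ∈ Cᶜ, ContinuousAt f z := fun z hz =>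
    (hf.differentiableAt (hCo.mem_nhds hz)).continuousAt
  have hlS : ∀ p ∈ S, Tendsto (fun z => P z * f z) (𝓝[A] p) (𝓝 0) := by
    intro p hp
    have h1 : ContinuousAt (fun z : ℂ => ∏ q ∈ S.erase p, (z - q)) p := by fun_prop
    have h2 := (h1.tendsto.mono_left (nhdsWithin_le_nhds (s := A))).mul (hS p hp)
    rw [mul_zero] at h2
    refine h2.congr (fun z => ?_)
    simp only [hP]
    rw [← Finset.mul_prod_erase S _ hp]
    ring
  have hlC : ∀ z ∈ Cᶜ, Tendsto (fun z => P z * f z) (𝓝[A] z) (𝓝 (P z * f z)) := by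
    intro z hz
    exact ((hPc z).continuousAt.mul (hfc z hz)).tendsto.mono_left nhdsWithin_le_nhds
  set H : ℂ → ℂ := extendFrom A (fun z => P z * f z) with hH
  have hHc : Continuous H := by
    apply continuous_extendFrom hAd
    intro z
    by_cases hz : z ∈ S
    · exact ⟨0, hlS z hz⟩
    by_cases hzC : z ∈ C
    · obtain ⟨y, hy⟩ := hlim z hzC hz
      exact ⟨P z * y, ((hPc z).continuousAt.tendsto.mono_left nhdsWithin_le_nhds).mul hy⟩
    · exact ⟨_, hlC z hzC⟩
  have hHe : ∀ z ∈ Cᶜ, H z = P z * f z := fun z hz => extendFrom_eq (hAd z) (hlC z hz)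
  have hHd : Differentiable ℂ H := by
    apply entire_of_off_real H hHc
    exact (hPc.differentiableOn.mul (hf.mono hAC)).congr (fun z hz => hHe z (hAC hz))
  obtain ⟨K, hK, hKe⟩ := entire_factor S H hHd (fun p hp => extendFrom_eq (hAd p) (hlS p hp))
  have hKf : ∀ z ∈ Cᶜ, z ∉ S → K z = f z := by
    intro z hz hzS
    have h1 := hKe z
    rw [hHe z hz] at h1
    have hne : P z ≠ 0 := by
      simp only [hP]
      rw [Finset.prod_ne_zero_iff]
      intro q hq h
      exact hzS (sub_eq_zero.1 h ▸ hq)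
    exact (mul_left_cancel₀ hne h1).symm
  have hKL : Tendsto K (cocompact ℂ) (𝓝 L) := by
    rw [← Metric.cobounded_eq_cocompact]
    refine hinf.congr' ?_
    have e1 : Cᶜ ∈ cobounded ℂ := Bornology.isBounded_def.1 hC.isBounded
    have e2 : (↑S : Set ℂ)ᶜ ∈ cobounded ℂ := Bornology.isBounded_def.1 S.finite_toSet.isBounded
    filter_upwards [e1, e2] with z h1 h2
    exact (hKf z h1 (by simpa using h2)).symm
  have hKc : ∀ z, K z = L := fun z => hK.apply_eq_of_tendsto_cocompact z hKL
  intro z hz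
  -- density
  have hev : ∀ᶠ w in 𝓝[≠] z, f w = L := by
    have e1 : Cᶜ ∈ 𝓝[≠] z := mem_nhdsWithin_of_mem_nhds (hCo.mem_nhds hz)
    have e2 : (↑(S.erase z) : Set ℂ)ᶜ ∈ 𝓝[≠] z := mem_nhdsWithin_of_mem_nhds
      ((S.erase z).finite_toSet.isClosed.isOpen_compl.mem_nhds (by simp))
    filter_upwards [e1, e2, self_mem_nhdsWithin] with w h1 h2 h3
    rw [← hKf w h1 (fun h => h2 (Finset.mem_coe.2 (Finset.mem_erase.2 ⟨h3, h⟩))), hKc]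
  have t1 : Tendsto f (𝓝[≠] z) (𝓝 (f z)) := (hfc z hz).tendsto.mono_left nhdsWithin_le_nhds
  have t2 : Tendsto f (𝓝[≠] z) (𝓝 L) := tendsto_const_nhds.congr' (hev.mono fun _ h => h.symm)
  exact tendsto_nhds_unique t1 t2

lemma cover_points (a b : ℕ → ℝ) (N : ℕ) (x : ℝ) (h0 : a 0 ≤ x) (h1 : x ≤ b N)
    (h : ∀ k < N + 1, x ≠ a k ∧ x ≠ b k) :
    (∃ k < N + 1, x ∈ Set.Ioo (a k) (b k)) ∨
    (∃ k, k + 1 < N + 1 ∧ x ∈ Set.Ioo (b k) (a (k + 1))) := by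
  induction N with
  | zero =>
    left
    exact ⟨0, by simp, lt_of_le_of_ne h0 (h 0 (by simp)).1.symm,
      lt_of_le_of_ne h1 (h 0 (by simp)).2⟩
  | succ N ih =>
    rcases le_or_gt x (b N) with h2 | h2
    · rcases ih h2 (fun k hk => h k (by omega)) with ⟨k, hk, hx⟩ | ⟨k, hk, hx⟩
      · exact Or.inl ⟨k, by omega, hx⟩
      · exact Or.inr ⟨k, by omega, hx⟩
    · rcases lt_or_ge x (a (N + 1)) with h3 | h3
      · exact Or.inr ⟨N, by omega, h2, h3⟩
      · exact Or.inl ⟨N + 1, by omega, lt_of_le_of_ne h3 (h (N + 1) (by omega)).1.symm,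
          lt_of_le_of_ne h1 (h (N + 1) (by omega)).2⟩

lemma jump_cancel (A B J : Matrix (Fin 2) (Fin 2) ℂ) (hJ : J.det = 1) :
    (A * J) * (B * J).adjugate = A * B.adjugate := by
  rw [Matrix.adjugate_mul_distrib, Matrix.mul_assoc, ← Matrix.mul_assoc J,
    Matrix.mul_adjugate, hJ, one_smul, Matrix.one_mul]

lemma gapJump_det (θ : ℝ) : (gapJump θ).det = 1 := by
  rw [gapJump, Matrix.det_fin_two_of, ← Complex.exp_add]
  simp

lemma tendsto_mul_adj (M M' : ℂ → Matrix (Fin 2) (Fin 2) ℂ) (l : Filter ℂ)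
    (X X' : Matrix (Fin 2) (Fin 2) ℂ) (h : Tendsto M l (𝓝 X)) (h' : Tendsto M' l (𝓝 X')) :
    Tendsto (fun z => M' z * (M z).adjugate) l (𝓝 (X' * X.adjugate)) := by
  have hadj : Continuous (fun X : Matrix (Fin 2) (Fin 2) ℂ => X.adjugate) :=
    Continuous.matrix_adjugate continuous_id
  have h2 : Tendsto (fun z => (M z).adjugate) l (𝓝 X.adjugate) := (hadj.tendsto X).comp h
  exact Tendsto.mul h' h2

lemma limits_glue (M M' : ℂ → Matrix (Fin 2) (Fin 2) ℂ) (x : ℂ)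
    (J Mp Mm Mp' Mm' : Matrix (Fin 2) (Fin 2) ℂ) (hJ : J.det = 1)
    (h1 : Tendsto M (𝓝[{z : ℂ | 0 < z.im}] x) (𝓝 Mp))
    (h2 : Tendsto M (𝓝[{z : ℂ | z.im < 0}] x) (𝓝 Mm)) (h3 : Mp = Mm * J)
    (h1' : Tendsto M' (𝓝[{z : ℂ | 0 < z.im}] x) (𝓝 Mp'))
    (h2' : Tendsto M' (𝓝[{z : ℂ | z.im < 0}] x) (𝓝 Mm')) (h3' : Mp' = Mm' * J) :
    Tendsto (fun z => M' z * (M z).adjugate) (𝓝[{z : ℂ | z.im ≠ 0}] x)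
      (𝓝 (Mm' * Mm.adjugate)) := by
  have hset : {z : ℂ | z.im ≠ 0} = {z : ℂ | z.im < 0} ∪ {z : ℂ | 0 < z.im} := by
    ext z; exact ne_iff_lt_or_gt
  rw [hset, nhdsWithin_union]
  refine Tendsto.sup ?_ ?_
  · exact tendsto_mul_adj M M' _ _ _ h2 h2'
  · have := tendsto_mul_adj M M' _ _ _ h1 h1'
    rw [h3, h3', jump_cancel _ _ _ hJ] at this
    exact this

lemma adj_mul_one (N : ℕ) (hN : 1 ≤ N) (a b β : ℕ → ℝ)
    (M M' : ℂ → Matrix (Fin 2) (Fin 2) ℂ)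
    (hM : IsModelRHSolution N a b β M)
    (hM' : IsModelRHSolution N a b β M') :
    ∀ z ∈ (cutSet N a b)ᶜ, M' z * (M z).adjugate = 1 := by
  classical
  obtain ⟨N, rfl⟩ : ∃ m, N = m + 1 := ⟨N - 1, by omega⟩
  obtain ⟨hA, hB, hG, hI, hE⟩ := hM
  obtain ⟨hA', hB', hG', hI', hE'⟩ := hM'
  set C := cutSet (N + 1) a b with hC
  have hCc : IsCompact C := isCompact_Icc.image Complex.continuous_ofReal
  have hCr : ∀ z ∈ C, z.im = 0 := by rintro _ ⟨x, _, rfl⟩; simp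
  have hAC : {z : ℂ | z.im ≠ 0} ⊆ Cᶜ := fun z hz hzC => hz (hCr z hzC)
  let S : Finset ℂ := (Finset.range (N + 1)).image (fun k => (a k : ℂ)) ∪
    (Finset.range (N + 1)).image (fun k => (b k : ℂ))
  have hadjd : ∀ i j, DifferentiableOn ℂ (fun z => (M z).adjugate i j) Cᶜ := by
    intro i j
    fin_cases i <;> fin_cases j <;> simp [Matrix.adjugate_fin_two] <;>
      exact (hA _ _).differentiableOn
  have hadjE : ∀ k < N + 1, ∀ p ∈ ({a k, b k} : Set ℝ), ∀ i j,
      (fun z => (M z).adjugate i j) =O[𝓝[Cᶜ] ((p : ℝ) : ℂ)]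
        fun z => ‖z - (p : ℂ)‖ ^ (-(1 / 4) : ℝ) := by
    intro k hk p hp i j
    have h := hE k hk p hp
    fin_cases i <;> fin_cases j <;> simp only [Matrix.adjugate_fin_two]
    · exact h 1 1
    · exact (h 0 1).neg_left
    · exact (h 1 0).neg_left
    · exact h 0 0
  have hinf : ∀ (Q : ℂ → Matrix (Fin 2) (Fin 2) ℂ), (∀ i j,
      (fun z : ℂ => Q z i j - (1 : Matrix (Fin 2) (Fin 2) ℂ) i j)
      =O[Bornology.cobounded ℂ] fun z => z⁻¹) → Tendsto Q (cobounded ℂ) (𝓝 1) := by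
    intro Q hQ
    refine tendsto_pi_nhds.2 fun i => tendsto_pi_nhds.2 fun j => ?_
    have := (hQ i j).trans_tendsto Filter.tendsto_inv₀_cobounded
    exact tendsto_sub_nhds_zero_iff.1 this
  intro z hz
  ext i j
  refine key_const C hCc hCr S (fun z => (M' z * (M z).adjugate) i j) _ ?_ ?_ ?_ ?_ z hz
  · simp only [Matrix.mul_apply, Fin.sum_univ_two]
    exact ((hA' _ _).differentiableOn.mul (hadjd _ _)).add
      ((hA' _ _).differentiableOn.mul (hadjd _ _))
  · rintro _ ⟨x, hx, rfl⟩ hxS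
    have hne : ∀ k < N + 1, x ≠ a k ∧ x ≠ b k := by
      intro k hk
      constructor
      · rintro rfl
        exact hxS (Finset.mem_union_left _ (Finset.mem_image.2 ⟨k, by simpa using hk, rfl⟩))
      · rintro rfl
        exact hxS (Finset.mem_union_right _ (Finset.mem_image.2 ⟨k, by simpa using hk, rfl⟩))
    have hent : ∀ Y, Tendsto (fun z => M' z * (M z).adjugate) (𝓝[{z : ℂ | z.im ≠ 0}] (x : ℂ))
        (𝓝 Y) → Tendsto (fun z => (M' z * (M z).adjugate) i j) (𝓝[{z : ℂ | z.im ≠ 0}] (x : ℂ))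
        (𝓝 (Y i j)) := fun Y hY => tendsto_pi_nhds.1 (tendsto_pi_nhds.1 hY i) j
    rcases cover_points a b N x hx.1 hx.2 hne with ⟨k, hk, hxk⟩ | ⟨k, hk, hxk⟩
    · obtain ⟨Mp, Mm, h1, h2, h3⟩ := hB k hk x hxk
      obtain ⟨Mp', Mm', h1', h2', h3'⟩ := hB' k hk x hxk
      exact ⟨_, hent _ (limits_glue M M' x _ Mp Mm Mp' Mm' (by simp [Matrix.det_fin_two])
        h1 h2 h3 h1' h2' h3')⟩
    · obtain ⟨Mp, Mm, h1, h2, h3⟩ := hG k hk x hxk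
      obtain ⟨Mp', Mm', h1', h2', h3'⟩ := hG' k hk x hxk
      exact ⟨_, hent _ (limits_glue M M' x _ Mp Mm Mp' Mm' (gapJump_det _)
        h1 h2 h3 h1' h2' h3')⟩
  · intro p hp
    obtain ⟨k, hk, q, hq, rfl⟩ : ∃ k < N + 1, ∃ q ∈ ({a k, b k} : Set ℝ), (q : ℂ) = p := by
      rcases Finset.mem_union.1 hp with h | h
      · obtain ⟨k, hk, rfl⟩ := Finset.mem_image.1 h
        exact ⟨k, by simpa using hk, a k, by simp, rfl⟩
      · obtain ⟨k, hk, rfl⟩ := Finset.mem_image.1 h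
        exact ⟨k, by simpa using hk, b k, by simp, rfl⟩
    have h1 := hE' k hk q hq
    have h2 := hadjE k hk q hq
    have h3 : (fun z => (M' z * (M z).adjugate) i j) =O[𝓝[Cᶜ] (q : ℂ)]
        fun z => ‖z - (q : ℂ)‖ ^ (-(1 / 4) : ℝ) * ‖z - (q : ℂ)‖ ^ (-(1 / 4) : ℝ) := by
      simp only [Matrix.mul_apply, Fin.sum_univ_two]
      exact ((h1 _ _).mul (h2 _ _)).add ((h1 _ _).mul (h2 _ _))
    have h4 := ((isBigO_refl (fun z : ℂ => z - (q : ℂ)) (𝓝[{z : ℂ | z.im ≠ 0}] (q : ℂ))).norm_right).mul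
      (h3.mono (nhdsWithin_mono _ hAC))
    refine h4.trans_tendsto ?_
    have h5 : Tendsto (fun z : ℂ => ‖z - (q : ℂ)‖ ^ (1 / 2 : ℝ)) (𝓝[{z : ℂ | z.im ≠ 0}] (q : ℂ))
        (𝓝 0) := by
      have hc : Continuous (fun z : ℂ => ‖z - (q : ℂ)‖ ^ (1 / 2 : ℝ)) :=
        (by fun_prop : Continuous (fun z : ℂ => ‖z - (q : ℂ)‖)).rpow_const
          (fun _ => Or.inr (by norm_num))
      have := (hc.tendsto (q : ℂ)).mono_left (nhdsWithin_le_nhds (s := {z : ℂ | z.im ≠ 0}))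
      simpa using this
    refine h5.congr' ?_
    filter_upwards [self_mem_nhdsWithin] with w hw
    have hpos : 0 < ‖w - (q : ℂ)‖ := by
      rw [norm_pos_iff, sub_ne_zero]
      rintro rfl
      exact hw (by simp)
    rw [← Real.rpow_add hpos]
    nth_rewrite 2 [← Real.rpow_one ‖w - (q : ℂ)‖]
    rw [← Real.rpow_add hpos]
    norm_num
  · have := tendsto_mul_adj M M' _ _ _ (hinf M hI) (hinf M' hI')
    rw [Matrix.adjugate_one, Matrix.mul_one] at this
    exact tendsto_pi_nhds.1 (tendsto_pi_nhds.1 this i) j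

/-- The solution of the model Riemann-Hilbert problem is unique: two
solutions with the same data `N, aₖ, bₖ, αₖ, n` agree on `ℂ \ [a₁, b_N]`. -/
theorem model_RH_solution_unique (N : ℕ) (hN : 1 ≤ N) (a b α : ℕ → ℝ) (n : ℤ)
    (hab : ∀ k < N, a k < b k) (hba : ∀ k, k + 1 < N → b k < a (k + 1))
    (M M' : ℂ → Matrix (Fin 2) (Fin 2) ℂ)
    (hM : IsModelRHSolution N a b (fun k => (n : ℝ) * α k) M)
    (hM' : IsModelRHSolution N a b (fun k => (n : ℝ) * α k) M') :
    ∀ z ∈ (cutSet N a b)ᶜ, M z = M' z := by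
  intro z hz
  have h1 := adj_mul_one N hN a b _ M M' hM hM' z hz
  have h2 := adj_mul_one N hN a b _ M M hM hM z hz
  have h3 := mul_eq_one_comm.1 h2
  calc M z = (M' z * (M z).adjugate) * M z := by rw [h1, Matrix.one_mul]
    _ = M' z := by rw [Matrix.mul_assoc, h3, Matrix.mul_one]
end
end

section
/- For every ε > 0 there exists a constant C > 0 such that for every vector (β_1, …, β_{N−1}) ∈ ℝ^{N−1} and every solution M of the model Riemann–Hilbert problem with parameters (β_1, …, β_{N−1}), one has ‖M(z)‖ ≤ C and ‖M(z)^{−1}‖ ≤ C for all z ∈ ℂ \ [a_1, b_N] with |z − a_j| ≥ ε and |z − b_j| ≥ ε for all j = 1, …, N. In particular, taking β_k = n α_k, the solutions M of the model Riemann–Hilbert problem and their inverses are bounded on this set uniformly in the integer n. -/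
open Complex Filter Topology Asymptotics Bornology

noncomputable section

open Complex Filter Topology Asymptotics Bornology
noncomputable section

theorem RHaux_nsq (x y : ℝ) : ‖(x + y * I : ℂ)‖ ^ 2 = x ^ 2 + y ^ 2 := by
  rw [← Complex.normSq_eq_norm_sq, Complex.normSq_add_mul_I]

/-- Integrals over horizontal lines of a function analytic in the upper half plane with quadratic
decay vanish, and so does the integral of the boundary values. -/
theorem RHaux_line_int (f : ℂ → ℂ) (hf : DifferentiableOn ℂ f {z | 0 < z.im})
    (C R : ℝ) (hR : 0 < R) (hinf : ∀ z : ℂ, 0 < z.im → R ≤ ‖z‖ → ‖f z‖ ≤ C / ‖z‖ ^ 2)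
    (y : ℝ) (hy : 0 < y) : MeasureTheory.Integrable (fun x : ℝ => f (x + y * I)) := by
  have hc : Continuous (fun x : ℝ => f (x + y * I)) := by
    refine hf.continuousOn.comp_continuous (by fun_prop) ?_
    intro x; simp [hy]
  refine hc.locallyIntegrable.integrable_of_isBigO_cocompact
    (g := fun x : ℝ => (1 + x ^ 2)⁻¹) ?_ (integrable_inv_one_add_sq.integrableAtFilter _)
  refine IsBigO.of_bound (2 * |C|) ?_
  have h1 : ∀ᶠ x : ℝ in cocompact ℝ, max R 1 ≤ ‖x‖ :=
    (tendsto_norm_cocompact_atTop).eventually_ge_atTop _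
  filter_upwards [h1] with x hx
  have hx1 := (le_max_left R 1).trans hx
  have hx2 := (le_max_right R 1).trans hx
  rw [Real.norm_eq_abs] at hx1 hx2
  have hns := RHaux_nsq x y
  have hn : |x| ≤ ‖(x + y * I : ℂ)‖ := by
    have := Complex.abs_re_le_norm (x + y * I : ℂ)
    simpa using this
  have := hinf (x + y * I) (by simp [hy]) (hx1.trans hn)
  refine this.trans ?_
  rw [hns, Real.norm_of_nonneg (by positivity), ← div_eq_mul_inv]
  have hxs : 1 ≤ x ^ 2 := by rw [← sq_abs]; nlinarith
  calc C / (x ^ 2 + y ^ 2) ≤ |C| / (x ^ 2 + y ^ 2) := by gcongr; exact le_abs_self C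
    _ ≤ (2 * |C|) / (1 + x ^ 2) := by
      rw [div_le_div_iff₀ (by positivity) (by positivity)]
      have : |C| * (1 + x ^ 2) ≤ |C| * (2 * (x ^ 2 + y ^ 2)) := by
        gcongr; nlinarith [sq_nonneg y]
      linarith

theorem RHaux_line_const (f : ℂ → ℂ) (hf : DifferentiableOn ℂ f {z | 0 < z.im})
    (C R : ℝ) (hR : 0 < R) (hinf : ∀ z : ℂ, 0 < z.im → R ≤ ‖z‖ → ‖f z‖ ≤ C / ‖z‖ ^ 2)
    (y₁ y₂ : ℝ) (hy₁ : 0 < y₁) (hy : y₁ < y₂) :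
    ∫ x : ℝ, f (x + y₁ * I) = ∫ x : ℝ, f (x + y₂ * I) := by
  have hy₂ : 0 < y₂ := hy₁.trans hy
  have i1 := RHaux_line_int f hf C R hR hinf y₁ hy₁
  have i2 := RHaux_line_int f hf C R hR hinf y₂ hy₂
  have t1 := MeasureTheory.intervalIntegral_tendsto_integral i1 tendsto_neg_atTop_atBot tendsto_id
  have t2 := MeasureTheory.intervalIntegral_tendsto_integral i2 tendsto_neg_atTop_atBot tendsto_id
  have vert : ∀ σ : ℝ → ℝ, (∀ X, |σ X| = |X|) →
      Tendsto (fun X : ℝ => ∫ y : ℝ in y₁..y₂, f (σ X + y * I)) atTop (𝓝 0) := by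
    intro σ hσ
    have hlim : Tendsto (fun X : ℝ => C / X ^ 2 * |y₂ - y₁|) atTop (𝓝 0) := by
      have : Tendsto (fun X : ℝ => C / X ^ 2) atTop (𝓝 0) :=
        tendsto_const_nhds.div_atTop (tendsto_pow_atTop (by norm_num))
      simpa using this.mul_const (|y₂ - y₁|)
    refine squeeze_zero_norm' ?_ hlim
    filter_upwards [eventually_ge_atTop R] with X hX
    refine intervalIntegral.norm_integral_le_of_norm_le_const ?_
    intro y hyy
    rw [Set.uIoc_of_le hy.le] at hyy
    have hX0 : 0 < X := hR.trans_le hX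
    have hn : X ≤ ‖((σ X : ℝ) + y * I : ℂ)‖ := by
      have := Complex.abs_re_le_norm ((σ X : ℝ) + y * I : ℂ)
      simp only [add_re, ofReal_re, mul_re, I_re, mul_zero, ofReal_im, I_im, mul_one, sub_self,
        add_zero, hσ] at this
      exact (le_abs_self X).trans this
    have hb := hinf ((σ X : ℝ) + y * I) (by simpa using hy₁.trans hyy.1) (hX.trans hn)
    have hC : 0 ≤ C := by
      by_contra hc
      have : C / ‖((σ X : ℝ) + y * I : ℂ)‖ ^ 2 < 0 :=
        div_neg_of_neg_of_pos (not_le.mp hc) (by have := hX0.trans_le hn; positivity)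
      linarith [norm_nonneg (f ((σ X : ℝ) + y * I))]
    refine hb.trans ?_
    gcongr
  have v1 := vert id (fun X => rfl)
  have v2 := vert (fun X => -X) (fun X => abs_neg X)
  have rect : ∀ X : ℝ, (∫ x : ℝ in -X..X, f (x + y₁ * I)) - (∫ x : ℝ in -X..X, f (x + y₂ * I)) +
      I • (∫ y : ℝ in y₁..y₂, f (X + y * I)) - I • (∫ y : ℝ in y₁..y₂, f ((-X : ℝ) + y * I)) = 0 := by
    intro X
    have := Complex.integral_boundary_rect_eq_zero_of_differentiableOn f (-X + y₁ * I) (X + y₂ * I)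
      (hf.mono ?_)
    · simpa using this
    · intro z hz
      rw [Complex.mem_reProdIm] at hz
      have := hz.2
      simp only [add_im, neg_im, ofReal_im, mul_im, ofReal_re, I_im, mul_one, I_re, mul_zero,
        add_zero, neg_zero, zero_add] at this
      rw [Set.uIcc_of_le hy.le] at this
      exact hy₁.trans_le this.1
  have tot := ((t1.sub t2).add (v1.const_smul I)).sub (v2.const_smul I)
  have : (fun X : ℝ => (∫ x : ℝ in -X..X, f (x + y₁ * I)) - (∫ x : ℝ in -X..X, f (x + y₂ * I)) +
      I • (∫ y : ℝ in y₁..y₂, f (X + y * I)) - I • (∫ y : ℝ in y₁..y₂, f ((-X : ℝ) + y * I)))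
      = fun _ => 0 := funext rect
  have h0 := tendsto_nhds_unique (tot.congr (fun X => rect X)) tendsto_const_nhds
  simp only [smul_zero, add_zero, sub_zero] at h0
  exact sub_eq_zero.mp h0

theorem RHaux_line_zero (f : ℂ → ℂ) (hf : DifferentiableOn ℂ f {z | 0 < z.im})
    (C R : ℝ) (hR : 0 < R) (hinf : ∀ z : ℂ, 0 < z.im → R ≤ ‖z‖ → ‖f z‖ ≤ C / ‖z‖ ^ 2)
    (y : ℝ) (hy : 0 < y) : ∫ x : ℝ, f (x + y * I) = 0 := by
  have key : Tendsto (fun t : ℝ => ∫ x : ℝ, f (x + t * I)) atTop (𝓝 (∫ x : ℝ, (0 : ℂ))) := by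
    refine MeasureTheory.tendsto_integral_filter_of_dominated_convergence
      (fun x : ℝ => |C| * (1 + x ^ 2)⁻¹) ?_ ?_ ?_ ?_
    · filter_upwards [eventually_gt_atTop 0] with t ht
      exact (RHaux_line_int f hf C R hR hinf t ht).1
    · filter_upwards [eventually_ge_atTop (max R 1)] with t ht
      have ht1 := (le_max_left R 1).trans ht
      have ht2 := (le_max_right R 1).trans ht
      refine Eventually.of_forall fun x => ?_
      have hns := RHaux_nsq x t
      have hn : t ≤ ‖(x + t * I : ℂ)‖ := by
        have := Complex.abs_im_le_norm (x + t * I : ℂ)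
        simp at this
        exact (le_abs_self t).trans this
      refine (hinf (x + t * I) (by simp; linarith) (ht1.trans hn)).trans ?_
      rw [hns, ← div_eq_mul_inv]
      calc C / (x ^ 2 + t ^ 2) ≤ |C| / (x ^ 2 + t ^ 2) := by gcongr; exact le_abs_self C
        _ ≤ |C| / (1 + x ^ 2) := 
          div_le_div_of_nonneg_left (abs_nonneg C) (by positivity) (by nlinarith)
    · exact integrable_inv_one_add_sq.const_mul _
    · refine Eventually.of_forall fun x => ?_
      have hlim : Tendsto (fun X : ℝ => |C| / X ^ 2) atTop (𝓝 0) :=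
        tendsto_const_nhds.div_atTop (tendsto_pow_atTop (by norm_num))
      refine squeeze_zero_norm' ?_ hlim
      filter_upwards [eventually_ge_atTop (max R 1)] with t ht
      have ht1 := (le_max_left R 1).trans ht
      have ht2 := (le_max_right R 1).trans ht
      have hn : t ≤ ‖(x + t * I : ℂ)‖ := by
        have := Complex.abs_im_le_norm (x + t * I : ℂ)
        simp at this
        exact (le_abs_self t).trans this
      refine (hinf (x + t * I) (by simp; linarith) (ht1.trans hn)).trans ?_
      gcongr
      exact le_abs_self C
  have h2 : Tendsto (fun t : ℝ => ∫ x : ℝ, f (x + t * I)) atTop (𝓝 (∫ x : ℝ, f (x + y * I))) := by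
    refine tendsto_const_nhds.congr' ?_
    filter_upwards [eventually_gt_atTop y] with t ht
    exact RHaux_line_const f hf C R hR hinf y t hy ht
  simpa using tendsto_nhds_unique h2 key

theorem RHaux_half (f : ℂ → ℂ) (hf : DifferentiableOn ℂ f {z | 0 < z.im})
    (C R : ℝ) (hR : 0 < R) (hinf : ∀ z : ℂ, 0 < z.im → R ≤ ‖z‖ → ‖f z‖ ≤ C / ‖z‖ ^ 2)
    (B : ℝ → ℝ) (hB : MeasureTheory.Integrable B) (δ : ℝ) (hδ : 0 < δ)
    (hb : ∀ y, 0 < y → y < δ → ∀ᵐ x : ℝ, ‖f (x + y * I)‖ ≤ B x)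
    (fp : ℝ → ℂ) (hfp : ∀ᵐ x : ℝ, Tendsto f (𝓝[{z | 0 < z.im}] (x : ℂ)) (𝓝 (fp x))) :
    MeasureTheory.Integrable fp ∧ ∫ x, fp x = 0 := by
  have hev : ∀ᶠ y : ℝ in 𝓝[>] 0, 0 < y ∧ y < δ := by
    filter_upwards [Ioo_mem_nhdsGT hδ] with y hy using hy
  have hlim : ∀ᵐ x : ℝ, Tendsto (fun y : ℝ => f (x + y * I)) (𝓝[>] 0) (𝓝 (fp x)) := by
    filter_upwards [hfp] with x hx
    refine hx.comp (tendsto_nhdsWithin_iff.mpr ⟨?_, ?_⟩)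
    · have : Tendsto (fun y : ℝ => (x + y * I : ℂ)) (𝓝 0) (𝓝 (x + (0 : ℝ) * I)) := by
        apply Continuous.tendsto; fun_prop
      simpa using this.mono_left nhdsWithin_le_nhds
    · filter_upwards [self_mem_nhdsWithin] with y hy
      simpa using hy
  have hmeas : ∀ᶠ y : ℝ in 𝓝[>] 0, MeasureTheory.AEStronglyMeasurable
      (fun x : ℝ => f (x + y * I)) := by
    filter_upwards [hev] with y hy
    exact (RHaux_line_int f hf C R hR hinf y hy.1).1
  have hbd : ∀ᶠ y : ℝ in 𝓝[>] 0, ∀ᵐ x : ℝ, ‖f (x + y * I)‖ ≤ B x := by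
    filter_upwards [hev] with y hy using hb y hy.1 hy.2
  have hT := MeasureTheory.tendsto_integral_filter_of_dominated_convergence B hmeas hbd hB hlim
  have h0 : Tendsto (fun y : ℝ => ∫ x : ℝ, f (x + y * I)) (𝓝[>] 0) (𝓝 0) := by
    refine tendsto_const_nhds.congr' ?_
    filter_upwards [hev] with y hy
    exact (RHaux_line_zero f hf C R hR hinf y hy.1).symm
  refine ⟨?_, tendsto_nhds_unique hT h0⟩
  obtain ⟨u, hu⟩ := exists_seq_tendsto (𝓝[>] (0 : ℝ))
  have hus : ∃ n₀, ∀ n, n₀ ≤ n → 0 < u n ∧ u n < δ := by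
    simpa using hu.eventually hev
  obtain ⟨n₀, hn₀⟩ := hus
  have hu' : Tendsto (fun n => u (n + n₀)) atTop (𝓝[>] 0) := hu.comp (tendsto_add_atTop_nat n₀)
  have hv : ∀ n, 0 < u (n + n₀) ∧ u (n + n₀) < δ := fun n => hn₀ _ (Nat.le_add_left _ _)
  have hm : MeasureTheory.AEStronglyMeasurable fp := by
    refine aestronglyMeasurable_of_tendsto_ae atTop
      (f := fun n (x : ℝ) => f (x + (u (n + n₀) : ℝ) * I)) ?_ ?_
    · intro n; exact (RHaux_line_int f hf C R hR hinf _ (hv n).1).1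
    · filter_upwards [hlim] with x hx using hx.comp hu'
  refine hB.mono' hm ?_
  have hall : ∀ᵐ x : ℝ, ∀ n, ‖f (x + (u (n + n₀) : ℝ) * I)‖ ≤ B x :=
    MeasureTheory.ae_all_iff.mpr fun n => hb _ (hv n).1 (hv n).2
  filter_upwards [hlim, hall] with x hx hx2
  exact le_of_tendsto (hx.comp hu').norm (Eventually.of_forall hx2)

end
open Complex Filter Topology Asymptotics Bornology
noncomputable section

/-- The weight controlling squares of solutions near the endpoints. -/
def RHW (P : Finset ℝ) (z : ℂ) : ℝ := 1 + ∑ p ∈ P, ‖z - (p : ℂ)‖ ^ (-(1 / 2) : ℝ)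

theorem RHW_one_le (P : Finset ℝ) (z : ℂ) : 1 ≤ RHW P z := by
  unfold RHW
  have : 0 ≤ ∑ p ∈ P, ‖z - (p : ℂ)‖ ^ (-(1 / 2) : ℝ) :=
    Finset.sum_nonneg fun p _ => by positivity
  linarith

theorem RHW_le_re (P : Finset ℝ) (z : ℂ) (hz : z.re ∉ P) : RHW P z ≤ RHW P (z.re : ℂ) := by
  unfold RHW
  refine add_le_add le_rfl (Finset.sum_le_sum fun p hp => ?_)
  have hne : z.re - p ≠ 0 := fun h => hz (by rwa [sub_eq_zero.mp h])
  have e : ‖((z.re : ℂ) - (p : ℂ))‖ = |z.re - p| := by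
    rw [← ofReal_sub, Complex.norm_real, Real.norm_eq_abs]
  rw [e]
  refine Real.rpow_le_rpow_of_nonpos (abs_pos.mpr hne) ?_ (by norm_num)
  have := Complex.abs_re_le_norm (z - p)
  simpa using this

theorem RHW_integrableOn (P : Finset ℝ) (R : ℝ) :
    MeasureTheory.IntegrableOn (fun x : ℝ => RHW P (x : ℂ)) (Set.Icc (-R) R) := by
  unfold RHW
  refine MeasureTheory.Integrable.add (by simp) ?_
  refine MeasureTheory.integrable_finsetSum _ fun p _ => ?_
  have hb : MeasureTheory.IntegrableOn (fun x : ℝ => ‖x‖ ^ (-(1 / 2) : ℝ))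
      (Metric.ball 0 (|R| + |p| + 1)) := by
    refine MeasureTheory.integrableOn_ball_of_norm_le_rpow (C := 1) (α := 1 / 2)
      (by simp) (by simp; norm_num) ?_ ?_
    · refine Eventually.of_forall fun x => ?_
      rw [Real.norm_of_nonneg (by positivity), one_mul]
    · exact (by fun_prop : Measurable fun x : ℝ => ‖x‖ ^ (-(1 / 2) : ℝ)).aestronglyMeasurable
  have hs : MeasureTheory.IntegrableOn (fun x : ℝ => ‖x - p‖ ^ (-(1 / 2) : ℝ))
      ((fun x : ℝ => x - p) ⁻¹' Metric.ball 0 (|R| + |p| + 1)) :=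
    ((MeasureTheory.measurePreserving_sub_right MeasureTheory.volume p).integrableOn_comp_preimage
      (measurableEmbedding_subRight p)).mpr hb
  have e : (fun x : ℝ => ‖(x : ℂ) - (p : ℂ)‖ ^ (-(1 / 2) : ℝ)) =
      fun x : ℝ => ‖x - p‖ ^ (-(1 / 2) : ℝ) := by
    funext x
    rw [← ofReal_sub, Complex.norm_real]
  rw [e]
  refine hs.mono_set ?_
  intro x hx
  simp only [Set.mem_preimage, Metric.mem_ball, dist_zero_right, Real.norm_eq_abs]
  have h1 : |x| ≤ |R| := abs_le.mpr ⟨by linarith [hx.1, le_abs_self R], hx.2.trans (le_abs_self R)⟩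
  have := abs_sub x p
  linarith

theorem RHaux_ae (P : Finset ℝ) : ∀ᵐ x : ℝ, x ∉ P := by
  have : MeasureTheory.volume (P : Set ℝ) = 0 := P.finite_toSet.measure_zero _
  exact MeasureTheory.measure_eq_zero_iff_ae_notMem.mp this

theorem RHaux_half' (P : Finset ℝ) (f : ℂ → ℂ) (hf : DifferentiableOn ℂ f {z | 0 < z.im})
    (C R : ℝ) (hR : 0 < R) (hinf : ∀ z : ℂ, 0 < z.im → R ≤ ‖z‖ → ‖f z‖ ≤ C / ‖z‖ ^ 2)
    (K δ : ℝ) (hδ : 0 < δ)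
    (hb : ∀ z : ℂ, 0 < z.im → z.im < δ → ‖f z‖ ≤ K * RHW P z)
    (fp : ℝ → ℂ) (hfp : ∀ x ∉ P, Tendsto f (𝓝[{z | 0 < z.im}] (x : ℂ)) (𝓝 (fp x))) :
    MeasureTheory.Integrable fp ∧ ∫ x, fp x = 0 := by
  set S := max R 1 with hS
  have hS1 : 1 ≤ S := le_max_right _ _
  refine RHaux_half f hf C R hR hinf
    (fun x => (Set.Icc (-S) S).indicator (fun x : ℝ => |K| * RHW P (x : ℂ)) x
      + 2 * |C| * (1 + x ^ 2)⁻¹) ?_ δ hδ ?_ fp ?_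
  · refine MeasureTheory.Integrable.add ?_ (integrable_inv_one_add_sq.const_mul _)
    rw [MeasureTheory.integrable_indicator_iff measurableSet_Icc]
    exact (RHW_integrableOn P S).const_mul _
  · intro y hy hyδ
    filter_upwards [RHaux_ae P] with x hx
    by_cases hxS : x ∈ Set.Icc (-S) S
    · rw [Set.indicator_of_mem hxS]
      have h1 := hb (x + y * I) (by simpa using hy) (by simpa using hyδ)
      have h2 := RHW_le_re P (x + y * I) (by simpa using hx)
      have e : ((x + y * I : ℂ).re) = x := by simp
      rw [e] at h2
      have h3 : K * RHW P (x + y * I) ≤ |K| * RHW P (x : ℂ) := by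
        refine mul_le_mul (le_abs_self K) h2 ?_ (abs_nonneg K)
        linarith [RHW_one_le P (x + y * I)]
      have h4 : 0 ≤ 2 * |C| * (1 + x ^ 2)⁻¹ := by positivity
      linarith
    · rw [Set.indicator_of_notMem hxS, zero_add]
      have hxS' : S < |x| := by
        by_contra h
        exact hxS (abs_le.mp (not_lt.mp h))
      have hns := RHaux_nsq x y
      have hn : |x| ≤ ‖(x + y * I : ℂ)‖ := by
        have := Complex.abs_re_le_norm (x + y * I : ℂ)
        simpa using this
      have := hinf (x + y * I) (by simp [hy]) (((le_max_left _ _).trans hxS'.le).trans hn)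
      refine this.trans ?_
      rw [hns, ← div_eq_mul_inv]
      have hxs : 1 ≤ x ^ 2 := by rw [← sq_abs]; nlinarith
      calc C / (x ^ 2 + y ^ 2) ≤ |C| / (x ^ 2 + y ^ 2) := by gcongr; exact le_abs_self C
        _ ≤ (2 * |C|) / (1 + x ^ 2) := by
          rw [div_le_div_iff₀ (by positivity) (by positivity)]
          have : |C| * (1 + x ^ 2) ≤ |C| * (2 * (x ^ 2 + y ^ 2)) := by
            gcongr; nlinarith [sq_nonneg y]
          linarith
  · filter_upwards [RHaux_ae P] with x hx using hfp x hx

/-- Sectionally holomorphic functions with boundary values off a finite set. -/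
structure RHBV (P : Finset ℝ) (G : ℂ → ℂ) (Gp Gm : ℝ → ℂ) : Prop where
  diff : DifferentiableOn ℂ G {z | z.im ≠ 0}
  lp : ∀ x ∉ P, Tendsto G (𝓝[{z | 0 < z.im}] (x : ℂ)) (𝓝 (Gp x))
  lm : ∀ x ∉ P, Tendsto G (𝓝[{z | z.im < 0}] (x : ℂ)) (𝓝 (Gm x))
  bd : ∃ K, ∀ z : ℂ, z.im ≠ 0 → ‖G z‖ ≤ K * RHW P z
  inf : ∃ C R, 0 < R ∧ ∀ z : ℂ, z.im ≠ 0 → R ≤ ‖z‖ → ‖G z‖ ≤ C / ‖z‖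

theorem RHW_conj (P : Finset ℝ) (z : ℂ) : RHW P ((starRingEnd ℂ) z) = RHW P z := by
  unfold RHW
  congr 1
  refine Finset.sum_congr rfl fun p _ => ?_
  rw [← Complex.norm_conj]; simp

theorem RHaux_tendsto_conj_up (x : ℝ) : Tendsto (starRingEnd ℂ) (𝓝[{z | 0 < z.im}] (x : ℂ))
    (𝓝[{z | z.im < 0}] (x : ℂ)) := by
  refine tendsto_nhdsWithin_iff.mpr ⟨?_, ?_⟩
  · have := (Complex.continuous_conj.tendsto (x : ℂ))
    rw [Complex.conj_ofReal] at this
    exact this.mono_left nhdsWithin_le_nhds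
  · filter_upwards [self_mem_nhdsWithin] with z hz
    simpa using hz

theorem RHaux_tendsto_conj_dn (x : ℝ) : Tendsto (starRingEnd ℂ) (𝓝[{z | z.im < 0}] (x : ℂ))
    (𝓝[{z | 0 < z.im}] (x : ℂ)) := by
  refine tendsto_nhdsWithin_iff.mpr ⟨?_, ?_⟩
  · have := (Complex.continuous_conj.tendsto (x : ℂ))
    rw [Complex.conj_ofReal] at this
    exact this.mono_left nhdsWithin_le_nhds
  · filter_upwards [self_mem_nhdsWithin] with z hz
    simpa using hz

theorem RHaux_isOpen_im_ne : IsOpen {z : ℂ | z.im ≠ 0} :=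
  isOpen_ne_fun Complex.continuous_im continuous_const

theorem RHaux_diff_conj {G : ℂ → ℂ} (h : DifferentiableOn ℂ G {z | z.im ≠ 0}) :
    DifferentiableOn ℂ (fun z => (starRingEnd ℂ) (G ((starRingEnd ℂ) z))) {z | z.im ≠ 0} := by
  intro z hz
  have hz' : (starRingEnd ℂ z) ∈ {z : ℂ | z.im ≠ 0} := by simpa using hz
  have h1 : DifferentiableAt ℂ G (starRingEnd ℂ z) :=
    h.differentiableAt (RHaux_isOpen_im_ne.mem_nhds hz')
  have h2 := h1.conj_conj
  rw [Complex.conj_conj] at h2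
  exact h2.differentiableWithinAt

theorem RHBV.conj {P : Finset ℝ} {G : ℂ → ℂ} {Gp Gm : ℝ → ℂ} (h : RHBV P G Gp Gm) :
    RHBV P (fun z => (starRingEnd ℂ) (G ((starRingEnd ℂ) z)))
      (fun x => (starRingEnd ℂ) (Gm x)) (fun x => (starRingEnd ℂ) (Gp x)) where
  diff := RHaux_diff_conj h.diff
  lp x hx := (Complex.continuous_conj.tendsto _).comp ((h.lm x hx).comp (RHaux_tendsto_conj_up x))
  lm x hx := (Complex.continuous_conj.tendsto _).comp ((h.lp x hx).comp (RHaux_tendsto_conj_dn x))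
  bd := by
    obtain ⟨K, hK⟩ := h.bd
    refine ⟨K, fun z hz => ?_⟩
    rw [Complex.norm_conj, ← RHW_conj]
    exact hK _ (by simpa using hz)
  inf := by
    obtain ⟨C, R, hR, hK⟩ := h.inf
    refine ⟨C, R, hR, fun z hz hzR => ?_⟩
    rw [Complex.norm_conj, ← Complex.norm_conj z]
    exact hK _ (by simpa using hz) (by simpa using hzR)

end
open Complex Filter Topology Asymptotics Bornology
noncomputable section

theorem RHaux_poisson (x y : ℝ) (hy : 0 < y) :
    MeasureTheory.Integrable (fun s : ℝ => y / ((s - x) ^ 2 + y ^ 2)) ∧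
    ∫ s : ℝ, y / ((s - x) ^ 2 + y ^ 2) = Real.pi := by
  have e : (fun s : ℝ => y / ((s - x) ^ 2 + y ^ 2)) =
      fun s : ℝ => y⁻¹ * (fun t : ℝ => (fun u : ℝ => (1 + u ^ 2)⁻¹) (t / y)) (s - x) := by
    funext s
    simp only
    field_simp
    ring
  rw [e]
  constructor
  · refine MeasureTheory.Integrable.const_mul ?_ _
    exact (integrable_inv_one_add_sq.comp_div hy.ne').comp_sub_right x
  · rw [MeasureTheory.integral_const_mul,
      MeasureTheory.integral_sub_right_eq_self (fun t : ℝ => (fun u : ℝ => (1 + u ^ 2)⁻¹) (t / y)) x,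
      MeasureTheory.Measure.integral_comp_div (fun u : ℝ => (1 + u ^ 2)⁻¹) y, integral_univ_inv_one_add_sq, abs_of_pos hy, smul_eq_mul]
    field_simp

theorem RHaux_poisson' (z₀ : ℂ) (h : 0 < z₀.im) :
    MeasureTheory.Integrable (fun s : ℝ =>
      (z₀ - (starRingEnd ℂ) z₀) / (((s : ℂ) - (starRingEnd ℂ) z₀) * ((s : ℂ) - z₀))) ∧
    ∫ s : ℝ, (z₀ - (starRingEnd ℂ) z₀) / (((s : ℂ) - (starRingEnd ℂ) z₀) * ((s : ℂ) - z₀))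
      = 2 * Real.pi * I := by
  obtain ⟨h1, h2⟩ := RHaux_poisson z₀.re z₀.im h
  have e : (fun s : ℝ =>
      (z₀ - (starRingEnd ℂ) z₀) / (((s : ℂ) - (starRingEnd ℂ) z₀) * ((s : ℂ) - z₀))) =
      fun s : ℝ => (2 * I) * ((z₀.im / ((s - z₀.re) ^ 2 + z₀.im ^ 2) : ℝ) : ℂ) := by
    funext s
    have e1 : z₀ - (starRingEnd ℂ) z₀ = 2 * I * z₀.im := by
      apply Complex.ext <;> simp; ring
    have e2 : ((s : ℂ) - (starRingEnd ℂ) z₀) * ((s : ℂ) - z₀) =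
        (((s - z₀.re) ^ 2 + z₀.im ^ 2 : ℝ) : ℂ) := by
      apply Complex.ext <;> simp [pow_two] <;> ring
    rw [e1, e2]
    push_cast
    ring
  rw [e]
  refine ⟨h1.ofReal.const_mul _, ?_⟩
  rw [MeasureTheory.integral_const_mul, integral_complex_ofReal, h2]
  ring

theorem RHaux_im_le_norm_sub (z w : ℂ) : z.im - w.im ≤ ‖z - w‖ := by
  have := Complex.abs_im_le_norm (z - w)
  rw [Complex.sub_im] at this
  exact (le_abs_self _).trans this

theorem RHBV.lower {P : Finset ℝ} {G : ℂ → ℂ} {Gp Gm : ℝ → ℂ} (h : RHBV P G Gp Gm) (w : ℂ)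
    (hw : w.im < 0) :
    MeasureTheory.Integrable (fun s : ℝ => Gp s / ((s : ℂ) - w)) ∧
    ∫ s : ℝ, Gp s / ((s : ℂ) - w) = 0 := by
  obtain ⟨K, hK⟩ := h.bd
  obtain ⟨C, R, hR, hC⟩ := h.inf
  have hne : ∀ z : ℂ, 0 < z.im → z - w ≠ 0 := by
    intro z hz h0
    have := sub_eq_zero.mp h0
    rw [this] at hz; linarith
  refine RHaux_half' P (fun z => G z / (z - w)) ?_ (2 * |C|) (max R (2 * ‖w‖))
    (lt_max_of_lt_left hR) ?_ (K / (-w.im)) 1 one_pos ?_ _ ?_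
  · refine DifferentiableOn.div (h.diff.mono fun z hz => ne_of_gt hz) (by fun_prop) ?_
    intro z hz; exact hne z hz
  · intro z hz hzR
    have h1 := hC z hz.ne' ((le_max_left _ _).trans hzR)
    have h2 := (le_max_right _ _).trans hzR
    have hz0 : 0 < ‖z‖ := hR.trans_le ((le_max_left _ _).trans hzR)
    have h3 : ‖z‖ / 2 ≤ ‖z - w‖ := by
      have := norm_sub_norm_le z w
      linarith
    rw [norm_div]
    calc ‖G z‖ / ‖z - w‖ ≤ (|C| / ‖z‖) / (‖z‖ / 2) := by
          gcongr
          exact h1.trans (by gcongr; exact le_abs_self C)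
      _ = 2 * |C| / ‖z‖ ^ 2 := by field_simp
  · intro z hz _
    rw [norm_div]
    have h3 : -w.im ≤ ‖z - w‖ := by
      have := RHaux_im_le_norm_sub z w
      linarith
    have hk := hK z hz.ne'
    calc ‖G z‖ / ‖z - w‖ ≤ (K * RHW P z) / (-w.im) := by
          have : 0 ≤ K * RHW P z := (norm_nonneg _).trans hk
          have : 0 < -w.im := by linarith
          gcongr
      _ = _ := by ring
  · intro x hx
    refine (h.lp x hx).div ?_ ?_
    · have : Tendsto (fun z : ℂ => z - w) (𝓝 (x : ℂ)) (𝓝 ((x : ℂ) - w)) := by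
        apply Continuous.tendsto; fun_prop
      exact this.mono_left nhdsWithin_le_nhds
    · intro h0
      have := sub_eq_zero.mp h0
      rw [← this] at hw; simp at hw

theorem RHBV.upper {P : Finset ℝ} {G : ℂ → ℂ} {Gp Gm : ℝ → ℂ} (h : RHBV P G Gp Gm) (z₀ : ℂ)
    (hz₀ : 0 < z₀.im) :
    MeasureTheory.Integrable (fun s : ℝ => Gp s / ((s : ℂ) - z₀)) ∧
    ∫ s : ℝ, Gp s / ((s : ℂ) - z₀) = 2 * Real.pi * I * G z₀ := by
  obtain ⟨K, hK⟩ := h.bd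
  obtain ⟨C, R, hR, hC⟩ := h.inf
  set w : ℂ := (starRingEnd ℂ) z₀ with hw
  have hwim : w.im = -z₀.im := by simp [hw]
  have hwn : ‖w‖ = ‖z₀‖ := by simp [hw]
  have hne : ∀ z : ℂ, 0 < z.im → z - w ≠ 0 := by
    intro z hz h0
    have := sub_eq_zero.mp h0
    rw [this] at hz; linarith
  have hner : ∀ x : ℝ, (x : ℂ) - w ≠ 0 := by
    intro x h0
    have := congrArg Complex.im (sub_eq_zero.mp h0)
    rw [hwim] at this; simp at this; linarith
  have hner' : ∀ x : ℝ, (x : ℂ) - z₀ ≠ 0 := by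
    intro x h0
    have := congrArg Complex.im (sub_eq_zero.mp h0)
    simp at this; linarith
  set c : ℂ := G z₀ * (z₀ - w) with hc
  set g : ℂ → ℂ := fun z => G z * (z - w) with hg
  have hopen : IsOpen {z : ℂ | 0 < z.im} := isOpen_lt continuous_const Complex.continuous_im
  have hgd : DifferentiableOn ℂ g {z | 0 < z.im} :=
    (h.diff.mono fun z hz => ne_of_gt hz).mul (by fun_prop)
  have hds : DifferentiableOn ℂ (dslope g z₀) {z | 0 < z.im} :=
    (Complex.differentiableOn_dslope (hopen.mem_nhds hz₀)).mpr hgd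
  have hform : ∀ z : ℂ, 0 < z.im → z ≠ z₀ →
      dslope g z₀ z / (z - w) = (G z - c / (z - w)) / (z - z₀) := by
    intro z hz hzz
    have h1 := hne z hz
    have h2 : z - z₀ ≠ 0 := sub_ne_zero.mpr hzz
    rw [dslope_of_ne _ hzz, slope_def_field]
    simp only [hg, hc]
    field_simp
  have key := RHaux_half' P (fun z => dslope g z₀ z / (z - w)) ?_
    (2 * (|C| + 2 * ‖c‖)) (max R (2 * ‖z₀‖ + 1)) (lt_max_of_lt_left hR) ?_
    ((|K| + ‖c‖ / z₀.im) / (z₀.im / 2)) (z₀.im / 2) (by linarith) ?_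
    (fun s : ℝ => (Gp s - c / ((s : ℂ) - w)) / ((s : ℂ) - z₀)) ?_
  · obtain ⟨k1, k2⟩ := key
    obtain ⟨p1, p2⟩ := RHaux_poisson' z₀ hz₀
    have e : (fun s : ℝ => Gp s / ((s : ℂ) - z₀)) =
        fun s : ℝ => (Gp s - c / ((s : ℂ) - w)) / ((s : ℂ) - z₀) +
          G z₀ * ((z₀ - w) / (((s : ℂ) - w) * ((s : ℂ) - z₀))) := by
      funext s
      have h1 := hner s
      have h2 := hner' s
      simp only [hc]
      field_simp
      ring
    rw [e]
    refine ⟨k1.add (p1.const_mul _), ?_⟩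
    rw [MeasureTheory.integral_add k1 (p1.const_mul _), k2, MeasureTheory.integral_const_mul, p2]
    ring
  · exact hds.div (by fun_prop) fun z hz => hne z hz
  · intro z hz hzR
    have hz1 := (le_max_left _ _).trans hzR
    have hz2 := (le_max_right _ _).trans hzR
    have hz0 : 0 < ‖z‖ := hR.trans_le hz1
    have hzz : z ≠ z₀ := by
      rintro rfl; linarith [norm_nonneg z]
    rw [hform z hz hzz]
    have h1 := hC z hz.ne' hz1
    have h3 : ‖z‖ / 2 ≤ ‖z - w‖ := by
      have := norm_sub_norm_le z w
      linarith
    have h4 : ‖z‖ / 2 ≤ ‖z - z₀‖ := by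
      have := norm_sub_norm_le z z₀
      linarith
    have h5 : ‖c / (z - w)‖ ≤ ‖c‖ / (‖z‖ / 2) := by
      rw [norm_div]; gcongr
    have h6 : ‖G z - c / (z - w)‖ ≤ (|C| + 2 * ‖c‖) / ‖z‖ := by
      calc _ ≤ ‖G z‖ + ‖c / (z - w)‖ := norm_sub_le _ _
        _ ≤ |C| / ‖z‖ + ‖c‖ / (‖z‖ / 2) := by
          refine add_le_add (h1.trans ?_) h5
          gcongr; exact le_abs_self C
        _ = _ := by field_simp
    rw [norm_div]
    calc _ ≤ ((|C| + 2 * ‖c‖) / ‖z‖) / (‖z‖ / 2) := by gcongr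
      _ = _ := by field_simp
  · intro z hz hzδ
    have hzz : z ≠ z₀ := by
      rintro rfl; linarith
    rw [hform z hz hzz]
    have hk := hK z hz.ne'
    have hW := RHW_one_le P z
    have h3 : z₀.im ≤ ‖z - w‖ := by
      have := RHaux_im_le_norm_sub z w
      linarith
    have h4 : z₀.im / 2 ≤ ‖z - z₀‖ := by
      have := RHaux_im_le_norm_sub z₀ z
      rw [norm_sub_rev]
      linarith
    have h5 : ‖c / (z - w)‖ ≤ ‖c‖ / z₀.im := by
      rw [norm_div]; gcongr
    have h6 : ‖G z - c / (z - w)‖ ≤ (|K| + ‖c‖ / z₀.im) * RHW P z := by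
      have h7 : 0 ≤ ‖c‖ / z₀.im := by positivity
      have h8 : K * RHW P z ≤ |K| * RHW P z := by
        have := le_abs_self K
        gcongr
      calc _ ≤ ‖G z‖ + ‖c / (z - w)‖ := norm_sub_le _ _
        _ ≤ |K| * RHW P z + (‖c‖ / z₀.im) * 1 := by linarith
        _ ≤ |K| * RHW P z + (‖c‖ / z₀.im) * RHW P z := by gcongr
        _ = _ := by ring
    rw [norm_div]
    calc _ ≤ ((|K| + ‖c‖ / z₀.im) * RHW P z) / (z₀.im / 2) := by gcongr
      _ = _ := by ring
  · intro x hx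
    have hcts : ∀ v : ℂ, Tendsto (fun z : ℂ => z - v) (𝓝[{z | 0 < z.im}] (x : ℂ)) (𝓝 ((x : ℂ) - v)) := by
      intro v
      have : Tendsto (fun z : ℂ => z - v) (𝓝 (x : ℂ)) (𝓝 ((x : ℂ) - v)) := by
        apply Continuous.tendsto; fun_prop
      exact this.mono_left nhdsWithin_le_nhds
    have hlim : Tendsto (fun z => (G z - c / (z - w)) / (z - z₀)) (𝓝[{z | 0 < z.im}] (x : ℂ))
        (𝓝 ((Gp x - c / ((x : ℂ) - w)) / ((x : ℂ) - z₀))) :=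
      ((h.lp x hx).sub (tendsto_const_nhds.div (hcts w) (hner x))).div (hcts z₀) (hner' x)
    refine hlim.congr' ?_
    have hnz : ∀ᶠ z in 𝓝[{z : ℂ | 0 < z.im}] (x : ℂ), z ≠ z₀ := by
      refine nhdsWithin_le_nhds (isOpen_ne.mem_nhds ?_)
      exact sub_ne_zero.mp (hner' x)
    filter_upwards [self_mem_nhdsWithin, hnz] with z hz hzz
    exact (hform z hz hzz).symm

/-- The Cauchy formula for sectionally holomorphic functions, upper half plane. -/
theorem RHBV.cauchy {P : Finset ℝ} {G : ℂ → ℂ} {Gp Gm : ℝ → ℂ} (h : RHBV P G Gp Gm) (z₀ : ℂ)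
    (hz₀ : 0 < z₀.im) :
    ∫ s : ℝ, (Gp s - Gm s) / ((s : ℂ) - z₀) = 2 * Real.pi * I * G z₀ := by
  obtain ⟨u1, u2⟩ := h.upper z₀ hz₀
  obtain ⟨l1, l2⟩ := h.conj.lower ((starRingEnd ℂ) z₀) (by simpa using hz₀)
  have e : (fun s : ℝ => Gm s / ((s : ℂ) - z₀)) = fun s : ℝ => (starRingEnd ℂ)
      ((starRingEnd ℂ) (Gm s) / ((s : ℂ) - (starRingEnd ℂ) z₀)) := by
    funext s; simp
  have hi : MeasureTheory.Integrable (fun s : ℝ => Gm s / ((s : ℂ) - z₀)) := by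
    rw [e]
    exact (Complex.conjLIE.integrable_comp_iff).mpr l1
  have hz : ∫ s : ℝ, Gm s / ((s : ℂ) - z₀) = 0 := by
    rw [e, integral_conj, l2, map_zero]
  have e2 : (fun s : ℝ => (Gp s - Gm s) / ((s : ℂ) - z₀)) =
      fun s : ℝ => Gp s / ((s : ℂ) - z₀) - Gm s / ((s : ℂ) - z₀) := by
    funext s; ring
  rw [e2, MeasureTheory.integral_sub u1 hi, u2, hz, sub_zero]

/-- The resulting bound in both half planes. -/
theorem RHBV.bound {P : Finset ℝ} {G : ℂ → ℂ} {Gp Gm : ℝ → ℂ} (h : RHBV P G Gp Gm) (ρ : ℝ → ℝ)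
    (hρ : MeasureTheory.Integrable ρ) (hle : ∀ᵐ s : ℝ, ‖Gp s - Gm s‖ ≤ ρ s) (z₀ : ℂ)
    (hz₀ : z₀.im ≠ 0) : ‖G z₀‖ ≤ (∫ s, ρ s) / |z₀.im| := by
  have main : ∀ (G : ℂ → ℂ) (Gp Gm : ℝ → ℂ), RHBV P G Gp Gm →
      (∀ᵐ s : ℝ, ‖Gp s - Gm s‖ ≤ ρ s) → ∀ z₀ : ℂ, 0 < z₀.im →
      ‖G z₀‖ ≤ (∫ s, ρ s) / z₀.im := by
    intro G Gp Gm h hle z₀ hz₀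
    have hc := h.cauchy z₀ hz₀
    have h1 : ‖∫ s : ℝ, (Gp s - Gm s) / ((s : ℂ) - z₀)‖ ≤ ∫ s : ℝ, ρ s / z₀.im := by
      refine MeasureTheory.norm_integral_le_of_norm_le (hρ.div_const _) ?_
      filter_upwards [hle] with s hs
      rw [norm_div]
      have h4 : z₀.im ≤ ‖(s : ℂ) - z₀‖ := by
        have := RHaux_im_le_norm_sub z₀ s
        rw [norm_sub_rev]
        simpa using this
      have : 0 ≤ ρ s := (norm_nonneg _).trans hs
      gcongr
    rw [hc, MeasureTheory.integral_div, norm_mul] at h1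
    have h2 : ‖(2 * Real.pi * I : ℂ)‖ = 2 * Real.pi := by
      simp [abs_of_pos Real.pi_pos]
    rw [h2] at h1
    have h3 : 1 ≤ 2 * Real.pi := by linarith [Real.pi_gt_three]
    nlinarith [norm_nonneg (G z₀)]
  rcases lt_or_gt_of_ne hz₀ with hneg | hpos
  · have := main _ _ _ h.conj ?_ ((starRingEnd ℂ) z₀) (by simpa using hneg)
    · simpa [abs_of_neg hneg] using this
    · filter_upwards [hle] with s hs
      rw [← map_sub, Complex.norm_conj, norm_sub_rev]
      exact hs
  · rw [abs_of_pos hpos]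
    exact main G Gp Gm h hle z₀ hpos

end
open Complex Filter Topology Asymptotics Bornology
noncomputable section

def RHgl (w : ℂ) : ℂ := w * Complex.log w

theorem RHgl_norm (w : ℂ) : ‖RHgl w‖ ≤ |‖w‖ * Real.log ‖w‖| + Real.pi * ‖w‖ := by
  unfold RHgl
  rw [norm_mul, abs_mul, abs_norm]
  have h1 := Complex.norm_le_abs_re_add_abs_im (Complex.log w)
  rw [Complex.log_re, Complex.log_im] at h1
  have h2 := Complex.abs_arg_le_pi w
  nlinarith [norm_nonneg w]

theorem RHgl_bdd (R : ℝ) : ∃ B : ℝ, ∀ w : ℂ, ‖w‖ ≤ R → ‖RHgl w‖ ≤ B := by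
  have hc : Continuous (fun r : ℝ => |r * Real.log r| + Real.pi * r) :=
    (Real.continuous_mul_log.abs).add (by fun_prop)
  obtain ⟨B, hB⟩ := (isCompact_Icc (a := 0) (b := R)).exists_bound_of_continuousOn hc.continuousOn
  refine ⟨B, fun w hw => (RHgl_norm w).trans ((le_abs_self _).trans ?_)⟩
  exact hB ‖w‖ ⟨norm_nonneg w, hw⟩

def RHjump (x : ℝ) : ℂ := if x < 0 then 2 * Real.pi * I * x else 0

theorem RHgl_zero : Tendsto RHgl (𝓝 0) (𝓝 0) := by
  have hc : Continuous (fun w : ℂ => |‖w‖ * Real.log ‖w‖| + Real.pi * ‖w‖) :=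
    ((Real.continuous_mul_log.comp continuous_norm).abs).add (by fun_prop)
  have := hc.tendsto 0
  simp only [norm_zero, Real.log_zero, mul_zero, abs_zero, add_zero] at this
  exact squeeze_zero_norm RHgl_norm this

theorem RHgl_up (x : ℝ) : Tendsto RHgl (𝓝[{z | 0 < z.im}] (x : ℂ)) (𝓝 (RHgl x)) := by
  rcases lt_trichotomy x 0 with hx | hx | hx
  · have h1 : ContinuousWithinAt Complex.log {z : ℂ | 0 ≤ z.im} (x : ℂ) :=
      Complex.continuousWithinAt_log_of_re_neg_of_im_zero (by simpa using hx) (by simp)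
    have h2 : ContinuousWithinAt RHgl {z : ℂ | 0 ≤ z.im} (x : ℂ) :=
      continuousWithinAt_id.mul h1
    exact h2.tendsto.mono_left (nhdsWithin_mono _ fun z (hz : 0 < z.im) => le_of_lt hz)
  · subst hx
    have : RHgl ((0 : ℝ) : ℂ) = 0 := by simp [RHgl]
    rw [this, ofReal_zero]
    exact RHgl_zero.mono_left nhdsWithin_le_nhds
  · have h1 : ContinuousAt Complex.log (x : ℂ) := continuousAt_clog (by simp [Complex.slitPlane, hx])
    have h2 : ContinuousAt RHgl (x : ℂ) := continuousAt_id.mul h1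
    exact h2.tendsto.mono_left nhdsWithin_le_nhds

theorem RHgl_dn (x : ℝ) : Tendsto RHgl (𝓝[{z | z.im < 0}] (x : ℂ)) (𝓝 (RHgl x - RHjump x)) := by
  rcases lt_trichotomy x 0 with hx | hx | hx
  · have h1 := Complex.tendsto_log_nhdsWithin_im_neg_of_re_neg_of_im_zero (z := (x : ℂ))
      (by simpa using hx) (by simp)
    have h2 : Tendsto (fun z : ℂ => z) (𝓝[{z | z.im < 0}] (x : ℂ)) (𝓝 (x : ℂ)) :=
      tendsto_id.mono_left nhdsWithin_le_nhds
    have h3 := h2.mul h1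
    have e : RHgl x - RHjump x = (x : ℂ) * (Real.log ‖(x : ℂ)‖ - Real.pi * I) := by
      unfold RHgl RHjump
      rw [if_pos hx]
      have : Complex.log x = Real.log ‖(x : ℂ)‖ + Real.pi * I := by
        rw [Complex.log, Complex.arg_ofReal_of_neg hx]
      rw [this]; ring
    rw [e]
    exact h3
  · subst hx
    have : RHgl ((0 : ℝ) : ℂ) - RHjump 0 = 0 := by simp [RHgl, RHjump]
    rw [this, ofReal_zero]
    exact RHgl_zero.mono_left nhdsWithin_le_nhds
  · have h1 : ContinuousAt Complex.log (x : ℂ) := continuousAt_clog (by simp [Complex.slitPlane, hx])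
    have h2 : ContinuousAt RHgl (x : ℂ) := continuousAt_id.mul h1
    have : RHjump x = 0 := by unfold RHjump; rw [if_neg (not_lt.mpr hx.le)]
    rw [this, sub_zero]
    exact h2.tendsto.mono_left nhdsWithin_le_nhds

def RHA (a b : ℝ) (z : ℂ) : ℂ := (RHgl (z - a) - RHgl (z - b)) / ((b - a : ℝ) : ℂ)

def RHAj (a b x : ℝ) : ℂ := (RHjump (x - a) - RHjump (x - b)) / ((b - a : ℝ) : ℂ)

theorem RHaux_shift_up (x a : ℝ) : Tendsto (fun z : ℂ => z - a) (𝓝[{z | 0 < z.im}] (x : ℂ))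
    (𝓝[{z | 0 < z.im}] ((x - a : ℝ) : ℂ)) := by
  refine tendsto_nhdsWithin_iff.mpr ⟨?_, ?_⟩
  · have : Tendsto (fun z : ℂ => z - a) (𝓝 (x : ℂ)) (𝓝 ((x : ℂ) - a)) := by
      apply Continuous.tendsto; fun_prop
    rw [ofReal_sub]
    exact this.mono_left nhdsWithin_le_nhds
  · filter_upwards [self_mem_nhdsWithin] with z hz
    simpa using hz

theorem RHaux_shift_dn (x a : ℝ) : Tendsto (fun z : ℂ => z - a) (𝓝[{z | z.im < 0}] (x : ℂ))
    (𝓝[{z | z.im < 0}] ((x - a : ℝ) : ℂ)) := by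
  refine tendsto_nhdsWithin_iff.mpr ⟨?_, ?_⟩
  · have : Tendsto (fun z : ℂ => z - a) (𝓝 (x : ℂ)) (𝓝 ((x : ℂ) - a)) := by
      apply Continuous.tendsto; fun_prop
    rw [ofReal_sub]
    exact this.mono_left nhdsWithin_le_nhds
  · filter_upwards [self_mem_nhdsWithin] with z hz
    simpa using hz

theorem RHA_up (a b x : ℝ) : Tendsto (RHA a b) (𝓝[{z | 0 < z.im}] (x : ℂ)) (𝓝 (RHA a b x)) := by
  have h1 := (RHgl_up (x - a)).comp (RHaux_shift_up x a)
  have h2 := (RHgl_up (x - b)).comp (RHaux_shift_up x b)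
  have := (h1.sub h2).div_const ((b - a : ℝ) : ℂ)
  have e : RHA a b x = (RHgl ((x - a : ℝ) : ℂ) - RHgl ((x - b : ℝ) : ℂ)) / ((b - a : ℝ) : ℂ) := by
    unfold RHA
    push_cast; ring
  rw [e]
  exact this

theorem RHA_dn (a b x : ℝ) : Tendsto (RHA a b) (𝓝[{z | z.im < 0}] (x : ℂ))
    (𝓝 (RHA a b x - RHAj a b x)) := by
  have h1 := (RHgl_dn (x - a)).comp (RHaux_shift_dn x a)
  have h2 := (RHgl_dn (x - b)).comp (RHaux_shift_dn x b)
  have := (h1.sub h2).div_const ((b - a : ℝ) : ℂ)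
  have e : RHA a b x - RHAj a b x = (RHgl ((x - a : ℝ) : ℂ) - RHjump (x - a) -
      (RHgl ((x - b : ℝ) : ℂ) - RHjump (x - b))) / ((b - a : ℝ) : ℂ) := by
    unfold RHA RHAj
    push_cast; ring
  rw [e]
  exact this

theorem RHAj_right (a b x : ℝ) (hab : a < b) (hx : b ≤ x) : RHAj a b x = 0 := by
  unfold RHAj RHjump
  rw [if_neg (by linarith), if_neg (by linarith)]; simp

theorem RHAj_left (a b x : ℝ) (hab : a < b) (hx : x < a) : RHAj a b x = 2 * Real.pi * I := by
  unfold RHAj RHjump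
  rw [if_pos (by linarith), if_pos (by linarith)]
  have : ((b - a : ℝ) : ℂ) ≠ 0 := by
    rw [Ne, ofReal_eq_zero]; linarith
  field_simp
  push_cast; ring

theorem RHA_diff (a b : ℝ) : DifferentiableOn ℂ (RHA a b) {z | z.im ≠ 0} := by
  have h : ∀ c : ℝ, DifferentiableOn ℂ (fun z : ℂ => RHgl (z - c)) {z | z.im ≠ 0} := by
    intro c
    unfold RHgl
    refine DifferentiableOn.mul (by fun_prop) (DifferentiableOn.clog (by fun_prop) ?_)
    intro z hz
    right
    simpa using hz
  exact ((h a).sub (h b)).div_const _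

theorem RHaux_log_mvt (z : ℂ) (hz : z.im ≠ 0) (S s t : ℝ) (hs : |s| ≤ S) (ht : |t| ≤ S)
    (hzS : 2 * S < ‖z‖) :
    ‖Complex.log (z - s) - Complex.log (z - t)‖ ≤ 4 * S / ‖z‖ := by
  have hz0 : 0 < ‖z‖ := by
    rw [norm_pos_iff]; rintro rfl; simp at hz
  have hS : 0 ≤ S := (abs_nonneg s).trans hs
  have hd : ∀ u : ℝ, HasDerivAt (fun u : ℝ => Complex.log (z - ((t + u * (s - t) : ℝ) : ℂ)))
      (-((s - t : ℝ) : ℂ) / (z - ((t + u * (s - t) : ℝ) : ℂ))) u := by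
    intro u
    refine HasDerivAt.clog_real ?_ (Or.inr (by simpa using hz))
    have h1 : HasDerivAt (fun u : ℝ => t + u * (s - t)) (s - t) u := by
      simpa using ((hasDerivAt_id u).mul_const (s - t)).const_add t
    exact (h1.ofReal_comp).const_sub z
  have := norm_image_sub_le_of_norm_deriv_le_segment_01'
    (f := fun u : ℝ => Complex.log (z - ((t + u * (s - t) : ℝ) : ℂ)))
    (f' := fun u : ℝ => -((s - t : ℝ) : ℂ) / (z - ((t + u * (s - t) : ℝ) : ℂ))) (C := 4 * S / ‖z‖)
    (fun u _ => (hd u).hasDerivWithinAt) ?_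
  · simpa using this
  · intro u hu
    have h1 : |t + u * (s - t)| ≤ S := by
      rw [abs_le] at hs ht ⊢
      constructor <;> nlinarith [hu.1, hu.2]
    have h2 : ‖z‖ / 2 ≤ ‖z - ((t + u * (s - t) : ℝ) : ℂ)‖ := by
      have := norm_sub_norm_le z ((t + u * (s - t) : ℝ) : ℂ)
      rw [Complex.norm_real, Real.norm_eq_abs] at this
      linarith
    have h3 : ‖-((s - t : ℝ) : ℂ)‖ ≤ 2 * S := by
      rw [norm_neg, Complex.norm_real, Real.norm_eq_abs]
      linarith [abs_sub s t]
    rw [norm_div]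
    calc _ ≤ (2 * S) / (‖z‖ / 2) := by gcongr
      _ = _ := by field_simp; ring

theorem RHA_sub_inf (z : ℂ) (hz : z.im ≠ 0) (S a b a' b' : ℝ) (hab : a < b) (hab' : a' < b')
    (ha : |a| ≤ S) (hb : |b| ≤ S) (ha' : |a'| ≤ S) (hb' : |b'| ≤ S) (hzS : 2 * S < ‖z‖) :
    ‖RHA a b z - RHA a' b' z‖ ≤ 4 * S / ‖z‖ := by
  have hd : ∀ (a b : ℝ), a < b → ∀ u : ℝ,
      HasDerivAt (fun u : ℝ => -RHgl (z - ((a + u * (b - a) : ℝ) : ℂ)) / ((b - a : ℝ) : ℂ))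
      (Complex.log (z - ((a + u * (b - a) : ℝ) : ℂ)) + 1) u := by
    intro a b hab u
    have h1 : HasDerivAt (fun u : ℝ => a + u * (b - a)) (b - a) u := by
      simpa using ((hasDerivAt_id u).mul_const (b - a)).const_add a
    have h2 : HasDerivAt (fun u : ℝ => z - ((a + u * (b - a) : ℝ) : ℂ)) (-((b - a : ℝ) : ℂ)) u :=
      (h1.ofReal_comp).const_sub z
    have hmem : (z - ((a + u * (b - a) : ℝ) : ℂ)) ∈ Complex.slitPlane := Or.inr (by simpa using hz)
    have h3 := h2.clog_real hmem
    have h4 := ((h2.mul h3).neg).div_const ((b - a : ℝ) : ℂ)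
    have hne : ((b - a : ℝ) : ℂ) ≠ 0 := by
      rw [Ne, ofReal_eq_zero]; linarith
    have hne2 := Complex.slitPlane_ne_zero hmem
    refine h4.congr_deriv ?_
    have key : ∀ w c : ℂ, w ≠ 0 → c ≠ 0 → -(-c * Complex.log w + w * (-c / w)) / c
        = Complex.log w + 1 := by
      intro w c hw hc
      field_simp
      ring
    exact key _ _ hne2 hne
  have := norm_image_sub_le_of_norm_deriv_le_segment_01'
    (f := fun u : ℝ => -RHgl (z - ((a + u * (b - a) : ℝ) : ℂ)) / ((b - a : ℝ) : ℂ)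
       - -RHgl (z - ((a' + u * (b' - a') : ℝ) : ℂ)) / ((b' - a' : ℝ) : ℂ))
    (f' := fun u : ℝ => (Complex.log (z - ((a + u * (b - a) : ℝ) : ℂ)) + 1)
       - (Complex.log (z - ((a' + u * (b' - a') : ℝ) : ℂ)) + 1)) (C := 4 * S / ‖z‖)
    (fun u _ => ((hd a b hab u).sub (hd a' b' hab' u)).hasDerivWithinAt) ?_
  · have e : RHA a b z - RHA a' b' z =
        (fun u : ℝ => -RHgl (z - ((a + u * (b - a) : ℝ) : ℂ)) / ((b - a : ℝ) : ℂ)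
       - -RHgl (z - ((a' + u * (b' - a') : ℝ) : ℂ)) / ((b' - a' : ℝ) : ℂ)) 1 -
       (fun u : ℝ => -RHgl (z - ((a + u * (b - a) : ℝ) : ℂ)) / ((b - a : ℝ) : ℂ)
       - -RHgl (z - ((a' + u * (b' - a') : ℝ) : ℂ)) / ((b' - a' : ℝ) : ℂ)) 0 := by
      simp only [one_mul, zero_mul, add_zero, add_sub_cancel]
      unfold RHA
      ring
    rw [e]; exact this
  · intro u hu
    rw [add_sub_add_right_eq_sub]
    have hcv : ∀ s t : ℝ, |s| ≤ S → |t| ≤ S → |s + u * (t - s)| ≤ S := by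
      intro s t hs ht
      rw [abs_le] at hs ht ⊢
      constructor <;> nlinarith [hu.1, hu.2]
    exact RHaux_log_mvt z hz S _ _ (hcv _ _ ha hb) (hcv _ _ ha' hb') hzS

theorem RHA_sub_bdd (S a b a' b' : ℝ) (hab : a < b) (hab' : a' < b')
    (ha : |a| ≤ S) (hb : |b| ≤ S) (ha' : |a'| ≤ S) (hb' : |b'| ≤ S) :
    ∃ B : ℝ, 0 ≤ B ∧ ∀ z : ℂ, z.im ≠ 0 → ‖RHA a b z - RHA a' b' z‖ ≤ B := by
  have hS : 0 ≤ S := (abs_nonneg _).trans ha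
  obtain ⟨B, hB⟩ := RHgl_bdd (2 * S + S)
  have hB0 : 0 ≤ B := (norm_nonneg _).trans (hB 0 (by simp; linarith))
  have h1 : 0 < b - a := by linarith
  have h2 : 0 < b' - a' := by linarith
  refine ⟨2 + (B + B) / (b - a) + (B + B) / (b' - a'), by positivity, fun z hz => ?_⟩
  by_cases hzS : 2 * S < ‖z‖
  · have := RHA_sub_inf z hz S a b a' b' hab hab' ha hb ha' hb' hzS
    have h3 : 4 * S / ‖z‖ ≤ 2 := by
      rw [div_le_iff₀ (by linarith)]; linarith
    have : 0 ≤ (B + B) / (b - a) + (B + B) / (b' - a') := by positivity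
    linarith
  · have hA : ∀ a b : ℝ, a < b → |a| ≤ S → |b| ≤ S → ‖RHA a b z‖ ≤ (B + B) / (b - a) := by
      intro a b hab ha hb
      have hsub : ∀ c : ℝ, |c| ≤ S → ‖z - (c : ℂ)‖ ≤ 2 * S + S := by
        intro c hc
        have := norm_sub_le z (c : ℂ)
        rw [Complex.norm_real, Real.norm_eq_abs] at this
        linarith [not_lt.mp hzS]
      unfold RHA
      have h1 : 0 < b - a := by linarith
      rw [norm_div, Complex.norm_real, Real.norm_of_nonneg h1.le]
      gcongr
      exact (norm_sub_le _ _).trans (add_le_add (hB _ (hsub a ha)) (hB _ (hsub b hb)))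
    have := norm_sub_le (RHA a b z) (RHA a' b' z)
    linarith [hA a b hab ha hb, hA a' b' hab' ha' hb']

end
open Complex Filter Topology Asymptotics Bornology
noncomputable section

theorem RHord (N : ℕ) (a b : ℕ → ℝ)
    (hab : ∀ k < N, a k < b k) (hba : ∀ k, k + 1 < N → b k < a (k + 1)) :
    ∀ j i, i < j → j < N → b i < a j := by
  intro j
  induction j with
  | zero => intro i hi; omega
  | succ j ih =>
    intro i hi hj
    rcases Nat.lt_succ_iff_lt_or_eq.mp hi with h | h
    · have h1 := ih i h (by omega)
      have h2 := hab j (by omega)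
      have h3 := hba j hj
      linarith
    · subst h; exact hba i hj

theorem RHgauge (N : ℕ) (hN : 1 ≤ N) (a b : ℕ → ℝ)
    (hab : ∀ k < N, a k < b k) (hba : ∀ k, k + 1 < N → b k < a (k + 1)) :
    ∃ K C R : ℝ, 0 ≤ K ∧ 0 ≤ C ∧ 0 < R ∧ ∀ β : ℕ → ℝ, ∃ (E : ℂ → ℂ) (Ep Em : ℝ → ℂ),
      DifferentiableOn ℂ E {z | z.im ≠ 0} ∧
      (∀ x : ℝ, Tendsto E (𝓝[{z | 0 < z.im}] (x : ℂ)) (𝓝 (Ep x))) ∧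
      (∀ x : ℝ, Tendsto E (𝓝[{z | z.im < 0}] (x : ℂ)) (𝓝 (Em x))) ∧
      (∀ z : ℂ, z.im ≠ 0 → ‖E z‖ ≤ K) ∧
      (∀ z : ℂ, z.im ≠ 0 → R ≤ ‖z‖ → ‖E z‖ ≤ C / ‖z‖) ∧
      (∀ k, k + 1 < N → ∀ x ∈ Set.Ioo (b k) (a (k + 1)),
        Ep x - Em x = -(2 * Real.pi * I * (Int.fract (β k) : ℝ))) ∧
      (∀ x : ℝ, x < a 0 ∨ b (N - 1) < x → Ep x - Em x = 0) := by
  have hord := RHord N a b hab hba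
  have haj : ∀ i j, i ≤ j → j < N → a i ≤ a j := by
    intro i j hij hj
    rcases hij.lt_or_eq with h | h
    · linarith [hord j i h hj, hab i (by omega)]
    · rw [h]
  have hbj : ∀ i j, i ≤ j → j < N → b i ≤ b j := by
    intro i j hij hj
    rcases hij.lt_or_eq with h | h
    · linarith [hord j i h hj, hab j hj]
    · rw [h]
  set S : ℝ := ∑ k ∈ Finset.range N, (|a k| + |b k|) with hSdef
  have hS : ∀ k < N, |a k| ≤ S ∧ |b k| ≤ S := by
    intro k hk
    have := Finset.single_le_sum (f := fun k => |a k| + |b k|) (s := Finset.range N)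
      (fun i _ => by positivity) (Finset.mem_range.mpr hk)
    constructor <;> linarith [abs_nonneg (a k), abs_nonneg (b k)]
  have hS0 : 0 ≤ S := Finset.sum_nonneg fun i _ => by positivity
  have hB : ∀ k, ∃ B : ℝ, 0 ≤ B ∧ (k + 1 < N → ∀ z : ℂ, z.im ≠ 0 →
      ‖RHA (a k) (b k) z - RHA (a (k+1)) (b (k+1)) z‖ ≤ B) := by
    intro k
    by_cases hk : k + 1 < N
    · obtain ⟨B, hB0, hB⟩ := RHA_sub_bdd S (a k) (b k) (a (k+1)) (b (k+1)) (hab k (by omega))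
        (hab _ hk) (hS k (by omega)).1 (hS k (by omega)).2 (hS _ hk).1 (hS _ hk).2
      exact ⟨B, hB0, fun _ => hB⟩
    · exact ⟨0, le_rfl, fun h => absurd h hk⟩
  choose B hB0 hB using hB
  refine ⟨∑ k ∈ Finset.range (N - 1), B k, ∑ k ∈ Finset.range (N - 1), 4 * S, 2 * S + 1,
    Finset.sum_nonneg fun i _ => hB0 i, Finset.sum_nonneg fun i _ => by positivity,
    by positivity, fun β => ?_⟩
  set f : ℕ → ℂ := fun k => ((Int.fract (β k) : ℝ) : ℂ) with hf
  have hfn : ∀ k, ‖f k‖ ≤ 1 := by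
    intro k
    simp only [hf]
    rw [Complex.norm_real, Real.norm_of_nonneg (Int.fract_nonneg _)]
    exact (Int.fract_lt_one _).le
  have hlt : ∀ k ∈ Finset.range (N - 1), k + 1 < N := by
    intro k hk
    have := Finset.mem_range.mp hk
    omega
  refine ⟨fun z => ∑ k ∈ Finset.range (N - 1), f k * (RHA (a k) (b k) z - RHA (a (k+1)) (b (k+1)) z),
    fun x => ∑ k ∈ Finset.range (N - 1), f k * (RHA (a k) (b k) x - RHA (a (k+1)) (b (k+1)) x),
    fun x => ∑ k ∈ Finset.range (N - 1), f k * ((RHA (a k) (b k) x - RHAj (a k) (b k) x) -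
      (RHA (a (k+1)) (b (k+1)) x - RHAj (a (k+1)) (b (k+1)) x)), ?_, ?_, ?_, ?_, ?_, ?_, ?_⟩
  · refine DifferentiableOn.fun_sum fun k _ => ?_
    exact ((RHA_diff _ _).sub (RHA_diff _ _)).const_mul _
  · intro x
    refine tendsto_finsetSum _ fun k _ => ?_
    exact ((RHA_up _ _ x).sub (RHA_up _ _ x)).const_mul _
  · intro x
    refine tendsto_finsetSum _ fun k _ => ?_
    exact ((RHA_dn _ _ x).sub (RHA_dn _ _ x)).const_mul _
  · intro z hz
    refine (norm_sum_le _ _).trans (Finset.sum_le_sum fun k hk => ?_)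
    rw [norm_mul]
    have := hB k (hlt k hk) z hz
    calc _ ≤ 1 * B k := by gcongr; exact hfn k
      _ = _ := one_mul _
  · intro z hz hzR
    rw [Finset.sum_div]
    refine (norm_sum_le _ _).trans (Finset.sum_le_sum fun k hk => ?_)
    rw [norm_mul]
    have hk' := hlt k hk
    have := RHA_sub_inf z hz S (a k) (b k) (a (k+1)) (b (k+1)) (hab k (by omega))
        (hab _ hk') (hS k (by omega)).1 (hS k (by omega)).2 (hS _ hk').1 (hS _ hk').2 (by linarith)
    calc _ ≤ 1 * (4 * S / ‖z‖) := by gcongr; exact hfn k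
      _ = _ := one_mul _
  · intro m hm x hx
    rw [← Finset.sum_sub_distrib, Finset.sum_eq_single m]
    · have e1 := RHAj_right (a m) (b m) x (hab m (by omega)) hx.1.le
      have e2 := RHAj_left (a (m+1)) (b (m+1)) x (hab _ hm) hx.2
      rw [e1, e2]; simp only [hf]; ring
    · intro k hk hkm
      have hk' := hlt k hk
      rcases lt_or_gt_of_ne hkm with h | h
      · have e1 := RHAj_right (a k) (b k) x (hab k (by omega))
          ((hbj k m h.le (by omega)).trans hx.1.le)
        have e2 := RHAj_right (a (k+1)) (b (k+1)) x (hab _ hk')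
          ((hbj (k+1) m h (by omega)).trans hx.1.le)
        rw [e1, e2]; ring
      · have e1 := RHAj_left (a k) (b k) x (hab k (by omega))
          (hx.2.trans_le (haj (m+1) k h (by omega)))
        have e2 := RHAj_left (a (k+1)) (b (k+1)) x (hab _ hk')
          (hx.2.trans_le (haj (m+1) (k+1) (by omega) (by omega)))
        rw [e1, e2]; ring
    · intro h
      exact absurd (Finset.mem_range.mpr (by omega)) h
  · intro x hx
    rw [← Finset.sum_sub_distrib]
    refine Finset.sum_eq_zero fun k hk => ?_
    have hk' := hlt k hk
    rcases hx with h | h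
    · have e1 := RHAj_left (a k) (b k) x (hab k (by omega))
          (h.trans_le (haj 0 k (by omega) (by omega)))
      have e2 := RHAj_left (a (k+1)) (b (k+1)) x (hab _ hk')
          (h.trans_le (haj 0 (k+1) (by omega) (by omega)))
      rw [e1, e2]; ring
    · have e1 := RHAj_right (a k) (b k) x (hab k (by omega))
          ((hbj k (N-1) (by omega) (by omega)).trans h.le)
      have e2 := RHAj_right (a (k+1)) (b (k+1)) x (hab _ hk')
          ((hbj (k+1) (N-1) (by omega) (by omega)).trans h.le)
      rw [e1, e2]; ring

end
open Complex Filter Topology Asymptotics Bornology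
noncomputable section

def RHP (N : ℕ) (a b : ℕ → ℝ) : Finset ℝ := (Finset.range N).image a ∪ (Finset.range N).image b

theorem RHP_mem (N : ℕ) (a b : ℕ → ℝ) (x : ℝ) :
    x ∈ RHP N a b ↔ ∃ k < N, x = a k ∨ x = b k := by
  unfold RHP
  simp only [Finset.mem_union, Finset.mem_image, Finset.mem_range]
  constructor
  · rintro (⟨k, hk, rfl⟩ | ⟨k, hk, rfl⟩)
    · exact ⟨k, hk, Or.inl rfl⟩
    · exact ⟨k, hk, Or.inr rfl⟩
  · rintro ⟨k, hk, rfl | rfl⟩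
    · exact Or.inl ⟨k, hk, rfl⟩
    · exact Or.inr ⟨k, hk, rfl⟩

theorem RHcls (a b : ℕ → ℝ) (x : ℝ) : ∀ N, 1 ≤ N → x ∉ RHP N a b →
    (∃ k < N, x ∈ Set.Ioo (a k) (b k)) ∨ (∃ k, k + 1 < N ∧ x ∈ Set.Ioo (b k) (a (k + 1))) ∨
    x < a 0 ∨ b (N - 1) < x := by
  intro N hN
  induction N, hN using Nat.le_induction with
  | base =>
    intro hx
    rw [RHP_mem] at hx
    push Not at hx
    obtain ⟨h1, h2⟩ := hx 0 (by omega)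
    rcases lt_or_gt_of_ne h1 with h | h
    · exact Or.inr (Or.inr (Or.inl h))
    · rcases lt_or_gt_of_ne h2 with h' | h'
      · exact Or.inl ⟨0, by omega, h, h'⟩
      · exact Or.inr (Or.inr (Or.inr h'))
  | succ n hn ih =>
    intro hx
    have hx' : x ∉ RHP n a b := by
      rw [RHP_mem] at hx ⊢
      rintro ⟨k, hk, h⟩
      exact hx ⟨k, by omega, h⟩
    rcases ih hx' with ⟨k, hk, h⟩ | ⟨k, hk, h⟩ | h | h
    · exact Or.inl ⟨k, by omega, h⟩
    · exact Or.inr (Or.inl ⟨k, by omega, h⟩)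
    · exact Or.inr (Or.inr (Or.inl h))
    · rw [RHP_mem] at hx
      push Not at hx
      obtain ⟨h1, h2⟩ := hx n (by omega)
      rcases lt_or_gt_of_ne h1 with h3 | h3
      · refine Or.inr (Or.inl ⟨n - 1, by omega, h, ?_⟩)
        rwa [Nat.sub_add_cancel hn]
      · rcases lt_or_gt_of_ne h2 with h' | h'
        · exact Or.inl ⟨n, by omega, h3, h'⟩
        · exact Or.inr (Or.inr (Or.inr h'))

instance RHneBot_up (x : ℝ) : NeBot (𝓝[{z : ℂ | 0 < z.im}] (x : ℂ)) := by
  rw [← mem_closure_iff_nhdsWithin_neBot, Complex.closure_setOfPred_lt_im]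
  simp

instance RHneBot_dn (x : ℝ) : NeBot (𝓝[{z : ℂ | z.im < 0}] (x : ℂ)) := by
  rw [← mem_closure_iff_nhdsWithin_neBot, Complex.closure_setOfPred_im_lt]
  simp

theorem RH_mem_compl (N : ℕ) (a b : ℕ → ℝ) (z : ℂ) (hz : z.im ≠ 0) : z ∈ (cutSet N a b)ᶜ := by
  rintro ⟨x, _, rfl⟩
  simp at hz

theorem RH_real_compl (N : ℕ) (a b : ℕ → ℝ) (x : ℝ) :
    (x : ℂ) ∈ (cutSet N a b)ᶜ ↔ (x < a 0 ∨ b (N - 1) < x) := by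
  unfold cutSet
  rw [Set.mem_compl_iff, Set.mem_image]
  constructor
  · intro h
    by_contra! h'
    exact h ⟨x, h', rfl⟩
  · rintro h ⟨y, hy, hxy⟩
    rw [ofReal_inj] at hxy
    subst hxy
    rcases h with h | h
    · linarith [hy.1]
    · linarith [hy.2]

structure RHS (N : ℕ) (a b β : ℕ → ℝ) (M : ℂ → Matrix (Fin 2) (Fin 2) ℂ)
    (Mp Mm : ℝ → Matrix (Fin 2) (Fin 2) ℂ) : Prop where
  diff : ∀ i j, DifferentiableOn ℂ (fun z => M z i j) {z | z.im ≠ 0}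
  lp : ∀ x ∉ RHP N a b, ∀ i j,
    Tendsto (fun z => M z i j) (𝓝[{z | 0 < z.im}] (x : ℂ)) (𝓝 (Mp x i j))
  lm : ∀ x ∉ RHP N a b, ∀ i j,
    Tendsto (fun z => M z i j) (𝓝[{z | z.im < 0}] (x : ℂ)) (𝓝 (Mm x i j))
  bd : ∃ C, 0 ≤ C ∧ ∀ z : ℂ, z.im ≠ 0 → ∀ i j, ‖M z i j‖ ^ 2 ≤ C * RHW (RHP N a b) z
  inf : ∃ c R, 0 ≤ c ∧ 1 ≤ R ∧ ∀ z : ℂ, R ≤ ‖z‖ → ∀ i j,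
    ‖M z i j - (1 : Matrix (Fin 2) (Fin 2) ℂ) i j‖ ≤ c / ‖z‖
  cut : ∀ x ∉ RHP N a b, ∀ k < N, x ∈ Set.Ioo (a k) (b k) → Mp x = Mm x * !![0, 1; -1, 0]
  gap : ∀ x ∉ RHP N a b, ∀ k, k + 1 < N → x ∈ Set.Ioo (b k) (a (k + 1)) →
    Mp x = Mm x * gapJump (β k)
  out : ∀ x ∉ RHP N a b, (x < a 0 ∨ b (N - 1) < x) → Mp x = Mm x

theorem RHS_bd (N : ℕ) (a b : ℕ → ℝ) (f : ℂ → ℂ)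
    (hd : DifferentiableOn ℂ f {z | z.im ≠ 0})
    (hp : ∀ x ∉ RHP N a b, ∃ l, Tendsto f (𝓝[{z | 0 < z.im}] (x : ℂ)) (𝓝 l))
    (hm : ∀ x ∉ RHP N a b, ∃ l, Tendsto f (𝓝[{z | z.im < 0}] (x : ℂ)) (𝓝 l))
    (hP : ∀ p ∈ RHP N a b, f =O[𝓝[(cutSet N a b)ᶜ] ((p : ℝ) : ℂ)]
        fun z => ‖z - (p : ℂ)‖ ^ (-(1 / 4) : ℝ))
    (B R : ℝ) (hinf : ∀ z, R ≤ ‖z‖ → ‖f z‖ ≤ B) :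
    ∃ C, 0 ≤ C ∧ ∀ z : ℂ, z.im ≠ 0 → ‖f z‖ ^ 2 ≤ C * RHW (RHP N a b) z := by
  set W := RHW (RHP N a b) with hW
  have hW1 : ∀ z, 1 ≤ W z := RHW_one_le _
  -- local bounds from a local bound of the norm
  have hloc : ∀ (B : ℝ) (z : ℂ), ‖f z‖ ≤ B → ‖f z‖ ^ 2 ≤ (B ^ 2) * W z := by
    intro B z h
    have h1 : ‖f z‖ ^ 2 ≤ B ^ 2 := by gcongr
    nlinarith [hW1 z, sq_nonneg B]
  have key : ∃ C, 0 ≤ C ∧ ∀ z ∈ Metric.closedBall (0 : ℂ) R, z.im ≠ 0 → ‖f z‖ ^ 2 ≤ C * W z := by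
    refine (isCompact_closedBall (0 : ℂ) R).induction_on
      (p := fun s => ∃ C, 0 ≤ C ∧ ∀ z ∈ s, z.im ≠ 0 → ‖f z‖ ^ 2 ≤ C * W z) ?_ ?_ ?_ ?_
    · exact ⟨0, le_rfl, fun z hz => absurd hz (by simp)⟩
    · rintro s t hst ⟨C, hC, h⟩
      exact ⟨C, hC, fun z hz => h z (hst hz)⟩
    · rintro s t ⟨C, hC, h⟩ ⟨C', hC', h'⟩
      refine ⟨C + C', by positivity, ?_⟩
      rintro z (hz | hz) hi
      · nlinarith [h z hz hi, hW1 z]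
      · nlinarith [h' z hz hi, hW1 z]
    · intro w _
      suffices h : ∃ C, 0 ≤ C ∧ ∀ᶠ z in 𝓝 w, z.im ≠ 0 → ‖f z‖ ^ 2 ≤ C * W z by
        obtain ⟨C, hC, h⟩ := h
        exact ⟨{z | z.im ≠ 0 → ‖f z‖ ^ 2 ≤ C * W z}, mem_nhdsWithin_of_mem_nhds h, C, hC,
          fun z hz => hz⟩
      by_cases hw : w.im = 0
      · obtain ⟨x, rfl⟩ : ∃ x : ℝ, (x : ℂ) = w := ⟨w.re, by apply Complex.ext <;> simp [hw]⟩
        by_cases hx : x ∈ RHP N a b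
        · obtain ⟨c, hc⟩ := (hP x hx).bound
          rw [eventually_nhdsWithin_iff] at hc
          refine ⟨c ^ 2, by positivity, ?_⟩
          filter_upwards [hc] with z hz hi
          have h1 := hz (RH_mem_compl N a b z hi)
          have h2 : ‖f z‖ ^ 2 ≤ (c * ‖‖z - (x : ℂ)‖ ^ (-(1 / 4) : ℝ)‖) ^ 2 := by gcongr
          have h3 : (‖‖z - (x : ℂ)‖ ^ (-(1 / 4) : ℝ)‖) ^ 2 ≤ W z := by
            rw [Real.norm_of_nonneg (by positivity), ← Real.rpow_natCast, ← Real.rpow_mul (by positivity)]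
            rw [hW]; unfold RHW
            have := Finset.single_le_sum (f := fun p : ℝ => ‖z - (p : ℂ)‖ ^ (-(1 / 2) : ℝ))
              (s := RHP N a b) (fun i _ => by positivity) hx
            norm_num at this ⊢
            linarith
          rw [mul_pow] at h2
          exact h2.trans (by gcongr)
        · obtain ⟨l, hl⟩ := hp x hx
          obtain ⟨l', hl'⟩ := hm x hx
          have e1 : ∀ᶠ z in 𝓝[{z | 0 < z.im}] (x : ℂ), ‖f z‖ < ‖l‖ + 1 :=
            hl.norm.eventually_lt_const (by linarith)
          have e2 : ∀ᶠ z in 𝓝[{z | z.im < 0}] (x : ℂ), ‖f z‖ < ‖l'‖ + 1 :=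
            hl'.norm.eventually_lt_const (by linarith)
          rw [eventually_nhdsWithin_iff] at e1 e2
          refine ⟨(‖l‖ + ‖l'‖ + 1) ^ 2, by positivity, ?_⟩
          filter_upwards [e1, e2] with z h1 h2 hi
          refine hloc _ z ?_
          rcases lt_or_gt_of_ne hi with h | h
          · linarith [h2 h, norm_nonneg l]
          · linarith [h1 h, norm_nonneg l']
      · have hc : ContinuousAt f w :=
          (hd.differentiableAt (RHaux_isOpen_im_ne.mem_nhds hw)).continuousAt
        have e1 : ∀ᶠ z in 𝓝 w, ‖f z‖ < ‖f w‖ + 1 :=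
          hc.tendsto.norm.eventually_lt_const (by linarith)
        refine ⟨(‖f w‖ + 1) ^ 2, by positivity, ?_⟩
        filter_upwards [e1] with z h1 _
        exact hloc _ z h1.le
  obtain ⟨C, hC, h⟩ := key
  refine ⟨C + B ^ 2, by positivity, fun z hz => ?_⟩
  rcases le_total ‖z‖ R with hR | hR
  · nlinarith [h z (by simpa using hR) hz, hW1 z, sq_nonneg B]
  · nlinarith [hloc B z (hinf z hR), hW1 z]

theorem RHS_mk (N : ℕ) (hN : 1 ≤ N) (a b β : ℕ → ℝ) (M : ℂ → Matrix (Fin 2) (Fin 2) ℂ)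
    (h : IsModelRHSolution N a b β M) : ∃ Mp Mm, RHS N a b β M Mp Mm := by
  obtain ⟨hA, hC, hG, hI, hE⟩ := h
  have hdiff : ∀ i j, DifferentiableOn ℂ (fun z => M z i j) {z | z.im ≠ 0} := fun i j z hz =>
    (hA i j z (RH_mem_compl N a b z hz)).differentiableAt.differentiableWithinAt
  have hcont : ∀ x : ℝ, (x < a 0 ∨ b (N - 1) < x) → Tendsto M (𝓝 (x : ℂ)) (𝓝 (M x)) := by
    intro x hx
    refine tendsto_pi_nhds.mpr fun i => tendsto_pi_nhds.mpr fun j => ?_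
    exact (hA i j x ((RH_real_compl N a b x).mpr hx)).continuousAt
  have hlim : ∀ x : ℝ, ∃ Mp Mm : Matrix (Fin 2) (Fin 2) ℂ, x ∉ RHP N a b →
      Tendsto M (𝓝[{z : ℂ | 0 < z.im}] (x : ℂ)) (𝓝 Mp) ∧
      Tendsto M (𝓝[{z : ℂ | z.im < 0}] (x : ℂ)) (𝓝 Mm) := by
    intro x
    by_cases hx : x ∈ RHP N a b
    · exact ⟨0, 0, fun h => absurd hx h⟩
    rcases RHcls a b x N hN hx with ⟨k, hk, h⟩ | ⟨k, hk, h⟩ | h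
    · obtain ⟨A, B, h1, h2, _⟩ := hC k hk x h
      exact ⟨A, B, fun _ => ⟨h1, h2⟩⟩
    · obtain ⟨A, B, h1, h2, _⟩ := hG k hk x h
      exact ⟨A, B, fun _ => ⟨h1, h2⟩⟩
    · exact ⟨M x, M x, fun _ => ⟨(hcont x h).mono_left nhdsWithin_le_nhds,
        (hcont x h).mono_left nhdsWithin_le_nhds⟩⟩
  choose Mp Mm hlim using hlim
  have hinf : ∃ c R, 0 ≤ c ∧ 1 ≤ R ∧ ∀ z : ℂ, R ≤ ‖z‖ → ∀ i j,
      ‖M z i j - (1 : Matrix (Fin 2) (Fin 2) ℂ) i j‖ ≤ c / ‖z‖ := by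
    have : ∀ i j, ∃ c R, 0 ≤ c ∧ 1 ≤ R ∧ ∀ z : ℂ, R ≤ ‖z‖ →
      ‖M z i j - (1 : Matrix (Fin 2) (Fin 2) ℂ) i j‖ ≤ c / ‖z‖ := by
      intro i j
      obtain ⟨c, hc0, hc⟩ := (hI i j).exists_nonneg
      have hc := hc.bound
      rw [← comap_norm_atTop, eventually_comap] at hc
      obtain ⟨R, hR⟩ := eventually_atTop.mp hc
      refine ⟨c, max R 1, hc0, le_max_right _ _, fun z hz => ?_⟩
      have := hR ‖z‖ ((le_max_left _ _).trans hz) z rfl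
      rwa [norm_inv] at this
    choose c R hc hR h using this
    refine ⟨c 0 0 + c 0 1 + c 1 0 + c 1 1, R 0 0 + R 0 1 + R 1 0 + R 1 1, ?_, ?_, ?_⟩
    · linarith [hc 0 0, hc 0 1, hc 1 0, hc 1 1]
    · linarith [hR 0 0, hR 0 1, hR 1 0, hR 1 1]
    · intro z hz i j
      have h1 : R i j ≤ ‖z‖ := by
        fin_cases i <;> fin_cases j <;> simp only [Fin.zero_eta, Fin.mk_one] <;>
        linarith [hR 0 0, hR 0 1, hR 1 0, hR 1 1]
      refine (h i j z h1).trans ?_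
      gcongr
      fin_cases i <;> fin_cases j <;> simp only [Fin.zero_eta, Fin.mk_one] <;>
        linarith [hc 0 0, hc 0 1, hc 1 0, hc 1 1]
  have hlp : ∀ x ∉ RHP N a b, ∀ i j,
      Tendsto (fun z => M z i j) (𝓝[{z | 0 < z.im}] (x : ℂ)) (𝓝 (Mp x i j)) := by
    intro x hx i j
    exact tendsto_pi_nhds.mp (tendsto_pi_nhds.mp (hlim x hx).1 i) j
  have hlm : ∀ x ∉ RHP N a b, ∀ i j,
      Tendsto (fun z => M z i j) (𝓝[{z | z.im < 0}] (x : ℂ)) (𝓝 (Mm x i j)) := by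
    intro x hx i j
    exact tendsto_pi_nhds.mp (tendsto_pi_nhds.mp (hlim x hx).2 i) j
  refine ⟨Mp, Mm, hdiff, hlp, hlm, ?_, hinf, ?_, ?_, ?_⟩
  · obtain ⟨c, R, hc, hR, hi⟩ := hinf
    have : ∀ i j, ∃ C, 0 ≤ C ∧ ∀ z : ℂ, z.im ≠ 0 → ‖M z i j‖ ^ 2 ≤ C * RHW (RHP N a b) z := by
      intro i j
      refine RHS_bd N a b _ (hdiff i j) (fun x hx => ⟨_, hlp x hx i j⟩)
        (fun x hx => ⟨_, hlm x hx i j⟩) ?_ (c + ‖(1 : Matrix (Fin 2) (Fin 2) ℂ) i j‖) R ?_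
      · intro p hp
        obtain ⟨k, hk, h⟩ := (RHP_mem N a b p).mp hp
        exact hE k hk p h i j
      · intro z hz
        have h1 := hi z hz i j
        have h2 : c / ‖z‖ ≤ c := div_le_self hc (hR.trans hz)
        have h3 := norm_sub_norm_le (M z i j) ((1 : Matrix (Fin 2) (Fin 2) ℂ) i j)
        linarith
    choose C hC h using this
    refine ⟨C 0 0 + C 0 1 + C 1 0 + C 1 1, ?_, fun z hz i j => (h i j z hz).trans ?_⟩
    · linarith [hC 0 0, hC 0 1, hC 1 0, hC 1 1]
    · have := RHW_one_le (RHP N a b) z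
      gcongr
      fin_cases i <;> fin_cases j <;> simp only [Fin.zero_eta, Fin.mk_one] <;>
        linarith [hC 0 0, hC 0 1, hC 1 0, hC 1 1]
  · intro x hx k hk hxk
    obtain ⟨A, B, h1, h2, e⟩ := hC k hk x hxk
    rw [tendsto_nhds_unique (hlim x hx).1 h1, tendsto_nhds_unique (hlim x hx).2 h2, e]
  · intro x hx k hk hxk
    obtain ⟨A, B, h1, h2, e⟩ := hG k hk x hxk
    rw [tendsto_nhds_unique (hlim x hx).1 h1, tendsto_nhds_unique (hlim x hx).2 h2, e]
  · intro x hx hxk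
    rw [tendsto_nhds_unique (hlim x hx).1 ((hcont x hxk).mono_left nhdsWithin_le_nhds),
      tendsto_nhds_unique (hlim x hx).2 ((hcont x hxk).mono_left nhdsWithin_le_nhds)]

theorem RHmulJ0 (A : Matrix (Fin 2) (Fin 2) ℂ) (i : Fin 2) :
    (A * (!![0, 1; -1, 0] : Matrix (Fin 2) (Fin 2) ℂ)) i 0 = -A i 1 := by
  simp [Matrix.mul_apply, Fin.sum_univ_two]

theorem RHmulJ1 (A : Matrix (Fin 2) (Fin 2) ℂ) (i : Fin 2) :
    (A * (!![0, 1; -1, 0] : Matrix (Fin 2) (Fin 2) ℂ)) i 1 = A i 0 := by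
  simp [Matrix.mul_apply, Fin.sum_univ_two]

theorem RHmulG0 (A : Matrix (Fin 2) (Fin 2) ℂ) (θ : ℝ) (i : Fin 2) :
    (A * gapJump θ) i 0 = A i 0 * Complex.exp (-(2 * Real.pi * θ) * Complex.I) := by
  simp [Matrix.mul_apply, Fin.sum_univ_two, gapJump]

theorem RHmulG1 (A : Matrix (Fin 2) (Fin 2) ℂ) (θ : ℝ) (i : Fin 2) :
    (A * gapJump θ) i 1 = A i 1 * Complex.exp ((2 * Real.pi * θ) * Complex.I) := by
  simp [Matrix.mul_apply, Fin.sum_univ_two, gapJump]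

theorem RHgexp (θ : ℝ) : Complex.exp (-(2 * Real.pi * θ) * Complex.I) *
    Complex.exp ((2 * Real.pi * θ) * Complex.I) = 1 := by
  rw [← Complex.exp_add]; ring_nf; simp

theorem RHS.det_one {N : ℕ} (hN : 1 ≤ N) {a b β : ℕ → ℝ} {M : ℂ → Matrix (Fin 2) (Fin 2) ℂ}
    {Mp Mm : ℝ → Matrix (Fin 2) (Fin 2) ℂ} (h : RHS N a b β M Mp Mm) (z : ℂ) (hz : z.im ≠ 0) :
    M z 0 0 * M z 1 1 - M z 0 1 * M z 1 0 = 1 := by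
  have hB : RHBV (RHP N a b) (fun z => M z 0 0 * M z 1 1 - M z 0 1 * M z 1 0 - 1)
      (fun x => Mp x 0 0 * Mp x 1 1 - Mp x 0 1 * Mp x 1 0 - 1)
      (fun x => Mm x 0 0 * Mm x 1 1 - Mm x 0 1 * Mm x 1 0 - 1) := by
    refine ⟨?_, ?_, ?_, ?_, ?_⟩
    · exact (((h.diff 0 0).mul (h.diff 1 1)).sub ((h.diff 0 1).mul (h.diff 1 0))).sub_const 1
    · intro x hx
      exact (((h.lp x hx 0 0).mul (h.lp x hx 1 1)).sub
        ((h.lp x hx 0 1).mul (h.lp x hx 1 0))).sub_const 1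
    · intro x hx
      exact (((h.lm x hx 0 0).mul (h.lm x hx 1 1)).sub
        ((h.lm x hx 0 1).mul (h.lm x hx 1 0))).sub_const 1
    · obtain ⟨C, hC, hb⟩ := h.bd
      refine ⟨2 * C + 1, fun z hz => ?_⟩
      have h1 := norm_sub_le (M z 0 0 * M z 1 1 - M z 0 1 * M z 1 0) 1
      have h2 := norm_sub_le (M z 0 0 * M z 1 1) (M z 0 1 * M z 1 0)
      rw [norm_mul, norm_mul] at h2
      rw [norm_one] at h1
      nlinarith [hb z hz 0 0, hb z hz 0 1, hb z hz 1 0, hb z hz 1 1, RHW_one_le (RHP N a b) z,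
        sq_nonneg (‖M z 0 0‖ - ‖M z 1 1‖), sq_nonneg (‖M z 0 1‖ - ‖M z 1 0‖)]
    · obtain ⟨c, R, hc, hR, hi⟩ := h.inf
      refine ⟨c * (1 + c) + c + c * (1 + c), R, by linarith, fun z hz hzR => ?_⟩
      have h00 := hi z hzR 0 0
      have h01 := hi z hzR 0 1
      have h10 := hi z hzR 1 0
      have h11 := hi z hzR 1 1
      simp at h00 h01 h10 h11
      have hz0 : 0 < ‖z‖ := by linarith
      have hcz : c / ‖z‖ ≤ c := div_le_self hc (hR.trans hzR)
      have h11' : ‖M z 1 1‖ ≤ 1 + c := by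
        have := norm_sub_norm_le (M z 1 1) 1
        rw [norm_one] at this; linarith
      have h10' : ‖M z 1 0‖ ≤ 1 + c := by linarith
      have e : M z 0 0 * M z 1 1 - M z 0 1 * M z 1 0 - 1 =
        (M z 0 0 - 1) * M z 1 1 + (M z 1 1 - 1) - M z 0 1 * M z 1 0 := by ring
      rw [e]
      calc _ ≤ ‖(M z 0 0 - 1) * M z 1 1‖ + ‖M z 1 1 - 1‖ + ‖M z 0 1 * M z 1 0‖ :=
            (norm_sub_le _ _).trans (by gcongr; exact norm_add_le _ _)
        _ ≤ c / ‖z‖ * (1 + c) + c / ‖z‖ + c / ‖z‖ * (1 + c) := by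
            rw [norm_mul, norm_mul]; gcongr
        _ = _ := by ring
  have := hB.bound (fun _ => 0) (by simp) ?_ z hz
  · simp at this
    exact sub_eq_zero.mp this
  · filter_upwards [RHaux_ae (RHP N a b)] with x hx
    rcases RHcls a b x N hN hx with ⟨k, hk, hh⟩ | ⟨k, hk, hh⟩ | hh
    · rw [h.cut x hx k hk hh, RHmulJ0, RHmulJ1, RHmulJ0, RHmulJ1]
      refine le_of_eq (norm_eq_zero.mpr ?_)
      ring
    · rw [h.gap x hx k hk hh, RHmulG0, RHmulG1, RHmulG0, RHmulG1]
      refine le_of_eq (norm_eq_zero.mpr ?_)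
      linear_combination (Mm x 0 0 * Mm x 1 1 - Mm x 0 1 * Mm x 1 0) * RHgexp (β k)
    · rw [h.out x hx hh]; simp

end
open Complex Filter Topology Asymptotics Bornology
noncomputable section

def RHcut (N : ℕ) (a b : ℕ → ℝ) : Set ℝ := ⋃ k ∈ Finset.range N, Set.Ioo (a k) (b k)

theorem RHcut_meas (N : ℕ) (a b : ℕ → ℝ) : MeasurableSet (RHcut N a b) :=
  Finset.measurableSet_biUnion _ fun _ _ => measurableSet_Ioo

theorem RHcut_mem (N : ℕ) (a b : ℕ → ℝ) (x : ℝ) :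
    x ∈ RHcut N a b ↔ ∃ k < N, x ∈ Set.Ioo (a k) (b k) := by
  simp only [RHcut, Set.mem_iUnion, Finset.mem_range, exists_prop]

section
variable {N : ℕ} {a b β : ℕ → ℝ} {M : ℂ → Matrix (Fin 2) (Fin 2) ℂ}
    {Mp Mm : ℝ → Matrix (Fin 2) (Fin 2) ℂ}

theorem RHaux_seq_dn (x : ℝ) : Tendsto (fun n : ℕ => (x : ℂ) - (((1 / ((n : ℝ) + 1)) : ℝ) : ℂ) * I) atTop
    (𝓝[{z | z.im < 0}] (x : ℂ)) := by
  refine tendsto_nhdsWithin_iff.mpr ⟨?_, Eventually.of_forall fun n => ?_⟩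
  · have h1 : Tendsto (fun n : ℕ => (((1 / ((n : ℝ) + 1)) : ℝ) : ℂ)) atTop (𝓝 ((0 : ℝ) : ℂ)) :=
      (Complex.continuous_ofReal.tendsto _).comp tendsto_one_div_add_atTop_nhds_zero_nat
    have := (h1.mul_const I).const_sub (x : ℂ)
    simpa using this
  · have : (0 : ℝ) < 1 / ((n : ℝ) + 1) := by positivity
    simp only [Set.mem_ofPred_eq, sub_im, ofReal_im, mul_im, ofReal_re, I_im, I_re, mul_one,
      mul_zero, add_zero, zero_sub]
    linarith

theorem RHS.Mm_meas (h : RHS N a b β M Mp Mm) (i j : Fin 2) :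
    MeasureTheory.AEStronglyMeasurable (fun x : ℝ => Mm x i j) MeasureTheory.volume := by
  refine aestronglyMeasurable_of_tendsto_ae atTop
    (f := fun (n : ℕ) (x : ℝ) => M ((x : ℂ) - (((1 / ((n : ℝ) + 1)) : ℝ) : ℂ) * I) i j) ?_ ?_
  · intro n
    have hc : Continuous (fun x : ℝ => M ((x : ℂ) - (((1 / ((n : ℝ) + 1)) : ℝ) : ℂ) * I) i j) := by
      refine (h.diff i j).continuousOn.comp_continuous
        (f := fun x : ℝ => (x : ℂ) - (((1 / ((n : ℝ) + 1)) : ℝ) : ℂ) * I) (by fun_prop) ?_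
      intro x
      have : (0 : ℝ) < 1 / ((n : ℝ) + 1) := by positivity
      simp only [Set.mem_ofPred_eq, sub_im, ofReal_im, mul_im, ofReal_re, I_im, I_re, mul_one,
        mul_zero, add_zero, zero_sub]
      linarith
    exact hc.aestronglyMeasurable
  · filter_upwards [RHaux_ae (RHP N a b)] with x hx
    exact (h.lm x hx i j).comp (RHaux_seq_dn x)

theorem RHS.Mm_bd (h : RHS N a b β M Mp Mm) : ∃ C, 0 ≤ C ∧ ∀ x ∉ RHP N a b, ∀ i j,
    ‖Mm x i j‖ ^ 2 ≤ C * RHW (RHP N a b) x := by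
  obtain ⟨C, hC, hb⟩ := h.bd
  refine ⟨C, hC, fun x hx i j => ?_⟩
  have h1 := (((h.lm x hx i j).comp (RHaux_seq_dn x)).norm.pow 2)
  refine le_of_tendsto h1 (Eventually.of_forall fun n => ?_)
  have hn : (0 : ℝ) < 1 / ((n : ℝ) + 1) := by positivity
  have him : ((x : ℂ) - (((1 / ((n : ℝ) + 1)) : ℝ) : ℂ) * I).im ≠ 0 := by
    simp only [sub_im, ofReal_im, mul_im, ofReal_re, I_im, I_re, mul_one,
        mul_zero, add_zero, zero_sub]
    linarith
  have hre : ((x : ℂ) - (((1 / ((n : ℝ) + 1)) : ℝ) : ℂ) * I).re = x := by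
    simp only [sub_re, ofReal_im, mul_re, ofReal_re, I_im, I_re, mul_one,
        mul_zero, sub_zero]
  refine (hb _ him i j).trans ?_
  have := RHW_le_re (RHP N a b) ((x : ℂ) - (((1 / ((n : ℝ) + 1)) : ℝ) : ℂ) * I) (by rwa [hre])
  rw [hre] at this
  gcongr

def RHrho (N : ℕ) (a b : ℕ → ℝ) (Mm : ℝ → Matrix (Fin 2) (Fin 2) ℂ) (i : Fin 2) : ℝ → ℝ :=
  (RHcut N a b).indicator fun s => ‖Mm s i 0‖ + ‖Mm s i 1‖

def RHsig (N : ℕ) (a b : ℕ → ℝ) (Mm : ℝ → Matrix (Fin 2) (Fin 2) ℂ) (i : Fin 2) : ℝ → ℝ :=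
  (RHcut N a b).indicator fun s => ‖Mm s i 0‖ ^ 2 + ‖Mm s i 1‖ ^ 2

theorem RHS.sig_int (h : RHS N a b β M Mp Mm) (i : Fin 2) (S : ℝ)
    (hS : RHcut N a b ⊆ Set.Icc (-S) S) :
    MeasureTheory.Integrable (RHsig N a b Mm i) := by
  unfold RHsig
  rw [MeasureTheory.integrable_indicator_iff (RHcut_meas N a b)]
  obtain ⟨C, hC, hb⟩ := h.Mm_bd
  have h1 := ((RHW_integrableOn (RHP N a b) S).mono_set hS).const_mul (2 * C)
  refine MeasureTheory.Integrable.mono' h1 ?_ ?_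
  · exact (((h.Mm_meas i 0).norm.pow 2).add ((h.Mm_meas i 1).norm.pow 2)).restrict
  · refine MeasureTheory.ae_restrict_of_ae ?_
    filter_upwards [RHaux_ae (RHP N a b)] with x hx
    rw [Real.norm_of_nonneg (by positivity)]
    linarith [hb x hx i 0, hb x hx i 1]

theorem RHS.rho_int (h : RHS N a b β M Mp Mm) (i : Fin 2) (S : ℝ)
    (hS : RHcut N a b ⊆ Set.Icc (-S) S) :
    MeasureTheory.Integrable (RHrho N a b Mm i) := by
  have h0 := h.sig_int i S hS
  unfold RHsig at h0
  unfold RHrho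
  rw [MeasureTheory.integrable_indicator_iff (RHcut_meas N a b)] at h0 ⊢
  have hf : MeasureTheory.IntegrableOn (fun _ : ℝ => (2 : ℝ)) (RHcut N a b) :=
    MeasureTheory.IntegrableOn.mono_set (by simp) hS
  refine MeasureTheory.Integrable.mono' (h0.add hf) ?_ ?_
  · exact ((h.Mm_meas i 0).norm.add (h.Mm_meas i 1).norm).restrict
  · refine Eventually.of_forall fun x => ?_
    rw [Real.norm_of_nonneg (by positivity)]
    simp only [Pi.add_apply]
    nlinarith [sq_nonneg (‖Mm x i 0‖ - 1), sq_nonneg (‖Mm x i 1‖ - 1), sq_nonneg (‖Mm x i 0‖),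
      sq_nonneg (‖Mm x i 1‖)]

theorem RHrho_nonneg (i : Fin 2) (s : ℝ) : 0 ≤ RHrho N a b Mm i s :=
  Set.indicator_nonneg (fun _ _ => by positivity) _

theorem RHsig_nonneg (i : Fin 2) (s : ℝ) : 0 ≤ RHsig N a b Mm i s :=
  Set.indicator_nonneg (fun _ _ => by positivity) _

theorem RHS.nu_mu (h : RHS N a b β M Mp Mm) (i : Fin 2) (S : ℝ) (hS0 : 0 < S)
    (hS : RHcut N a b ⊆ Set.Icc (-S) S) :
    (∫ s, RHrho N a b Mm i s) ^ 2 ≤ 4 * S * ∫ s, RHsig N a b Mm i s := by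
  set ν := ∫ s, RHrho N a b Mm i s with hν
  set μ := ∫ s, RHsig N a b Mm i s with hμ
  have hr := h.rho_int i S hS
  have hs := h.sig_int i S hS
  have hI : MeasureTheory.Integrable ((Set.Icc (-S) S).indicator fun _ : ℝ => (1 : ℝ)) := by
    rw [MeasureTheory.integrable_indicator_iff measurableSet_Icc]
    simp
  have hIv : ∫ s, (Set.Icc (-S) S).indicator (fun _ : ℝ => (1 : ℝ)) s = 2 * S := by
    rw [MeasureTheory.integral_indicator measurableSet_Icc]
    simp
    rw [max_eq_left (by linarith)]; ring
  have key : ∀ t : ℝ, 2 * t * ν ≤ t ^ 2 * (2 * S) + 2 * μ := by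
    intro t
    rw [hν, hμ, ← hIv, ← MeasureTheory.integral_const_mul, ← MeasureTheory.integral_const_mul,
      ← MeasureTheory.integral_const_mul, ← MeasureTheory.integral_add (hI.const_mul _) (hs.const_mul _)]
    refine MeasureTheory.integral_mono (hr.const_mul _) ((hI.const_mul _).add (hs.const_mul _)) ?_
    intro s
    simp only
    by_cases hm : s ∈ RHcut N a b
    · unfold RHrho RHsig
      rw [Set.indicator_of_mem hm, Set.indicator_of_mem hm, Set.indicator_of_mem (hS hm)]
      nlinarith [sq_nonneg (t - (‖Mm s i 0‖ + ‖Mm s i 1‖)), sq_nonneg (‖Mm s i 0‖ - ‖Mm s i 1‖)]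
    · unfold RHrho RHsig
      rw [Set.indicator_of_notMem hm, Set.indicator_of_notMem hm]
      have : 0 ≤ (Set.Icc (-S) S).indicator (fun _ : ℝ => (1 : ℝ)) s :=
        Set.indicator_nonneg (fun _ _ => zero_le_one) _
      nlinarith [mul_nonneg (sq_nonneg t) this]
  have := key (ν / (2 * S))
  have e1 : 2 * (ν / (2 * S)) * ν = ν ^ 2 / S := by field_simp
  have e2 : (ν / (2 * S)) ^ 2 * (2 * S) = ν ^ 2 / (2 * S) := by field_simp
  rw [e1, e2] at this
  have e3 : ν ^ 2 / S = 2 * (ν ^ 2 / (2 * S)) := by field_simp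
  rw [e3] at this
  have h4 : ν ^ 2 / (2 * S) ≤ 2 * μ := by linarith
  rw [div_le_iff₀ (by positivity)] at h4
  linarith

/-- energy identity -/
theorem RHS.energy (hN : 1 ≤ N) (h : RHS N a b β M Mp Mm) (i : Fin 2) (S T : ℝ) (hS0 : 0 < S)
    (hS : RHcut N a b ⊆ Set.Icc (-S) S) (hT : S ≤ T) :
    ∫ s, RHsig N a b Mm i s ≤ 4 * Real.pi * T * (‖M (T * I) i 0‖ * ‖M (-(T * I)) i 1‖) := by
  have hT0 : 0 < T := by linarith
  have hB : RHBV (RHP N a b) (fun z => M z i 0 * (starRingEnd ℂ) (M ((starRingEnd ℂ) z) i 1))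
      (fun x => Mp x i 0 * (starRingEnd ℂ) (Mm x i 1))
      (fun x => Mm x i 0 * (starRingEnd ℂ) (Mp x i 1)) := by
    refine ⟨?_, ?_, ?_, ?_, ?_⟩
    · exact (h.diff i 0).mul (RHaux_diff_conj (h.diff i 1))
    · intro x hx
      exact (h.lp x hx i 0).mul ((Complex.continuous_conj.tendsto _).comp
        ((h.lm x hx i 1).comp (RHaux_tendsto_conj_up x)))
    · intro x hx
      exact (h.lm x hx i 0).mul ((Complex.continuous_conj.tendsto _).comp
        ((h.lp x hx i 1).comp (RHaux_tendsto_conj_dn x)))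
    · obtain ⟨C, hC, hb⟩ := h.bd
      refine ⟨C, fun z hz => ?_⟩
      have h1 := hb z hz i 0
      have h2 := hb ((starRingEnd ℂ) z) (by simpa using hz) i 1
      rw [RHW_conj] at h2
      rw [norm_mul, Complex.norm_conj]
      nlinarith [sq_nonneg (‖M z i 0‖ - ‖M ((starRingEnd ℂ) z) i 1‖)]
    · obtain ⟨c, R, hc, hR, hi⟩ := h.inf
      refine ⟨c * (1 + c) + c * (1 + c), R, by linarith, fun z hz hzR => ?_⟩
      have hzR' : R ≤ ‖(starRingEnd ℂ) z‖ := by rwa [Complex.norm_conj]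
      have h0 := hi z hzR i 0
      have h1 := hi _ hzR' i 1
      rw [Complex.norm_conj] at h1
      rw [norm_mul, Complex.norm_conj]
      have hcz : c / ‖z‖ ≤ c := div_le_self hc (hR.trans hzR)
      have hz0 : 0 < ‖z‖ := by linarith
      have hcz0 : 0 ≤ c / ‖z‖ := by positivity
      have e : (c * (1 + c) + c * (1 + c)) / ‖z‖ = c / ‖z‖ * (1 + c) + c / ‖z‖ * (1 + c) := by ring
      rw [e]
      have hp : 0 ≤ c / ‖z‖ * (1 + c) := by positivity
      obtain rfl | rfl : i = 0 ∨ i = 1 := by omega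
      · simp at h0 h1 ⊢
        have h0' : ‖M z 0 0‖ ≤ 1 + c := by
          have := norm_sub_norm_le (M z 0 0) 1
          rw [norm_one] at this; linarith
        have : ‖M z 0 0‖ * ‖M ((starRingEnd ℂ) z) 0 1‖ ≤ (1 + c) * (c / ‖z‖) := by gcongr
        linarith
      · simp at h0 h1 ⊢
        have h0' : ‖M ((starRingEnd ℂ) z) 1 1‖ ≤ 1 + c := by
          have := norm_sub_norm_le (M ((starRingEnd ℂ) z) 1 1) 1
          rw [norm_one] at this; linarith
        have : ‖M z 1 0‖ * ‖M ((starRingEnd ℂ) z) 1 1‖ ≤ (c / ‖z‖) * (1 + c) := by gcongr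
        linarith
  have hc := hB.cauchy (T * I) (by simpa using hT0)
  have hcj : (starRingEnd ℂ) (T * I) = -(T * I) := by simp
  simp only [hcj] at hc
  have hs := h.sig_int i S hS
  have hae : ∀ᵐ s : ℝ, (Mp s i 0 * (starRingEnd ℂ) (Mm s i 1) - Mm s i 0 * (starRingEnd ℂ) (Mp s i 1)) /
      ((s : ℂ) - T * I) = -(((RHsig N a b Mm i s : ℝ) : ℂ) / ((s : ℂ) - T * I)) := by
    filter_upwards [RHaux_ae (RHP N a b)] with x hx
    rw [← neg_div]
    congr 1
    by_cases hm : x ∈ RHcut N a b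
    · unfold RHsig
      rw [Set.indicator_of_mem hm]
      obtain ⟨k, hk, hxk⟩ := (RHcut_mem N a b x).mp hm
      rw [h.cut x hx k hk hxk, RHmulJ0, RHmulJ1]
      push_cast
      rw [← Complex.mul_conj', ← Complex.mul_conj']
      ring
    · unfold RHsig
      rw [Set.indicator_of_notMem hm, ofReal_zero, neg_zero]
      rcases RHcls a b x N hN hx with ⟨k, hk, hh⟩ | ⟨k, hk, hh⟩ | hh
      · exact absurd ((RHcut_mem N a b x).mpr ⟨k, hk, hh⟩) hm
      · rw [h.gap x hx k hk hh, RHmulG0, RHmulG1, map_mul, ← Complex.exp_conj]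
        have : (starRingEnd ℂ) (2 * Real.pi * (β k : ℂ) * I) = -(2 * Real.pi * (β k : ℂ)) * I := by
          simp [Complex.conj_ofReal, Complex.conj_ofNat]
        rw [this]; ring
      · rw [h.out x hx hh]; ring
  rw [MeasureTheory.integral_congr_ae hae, MeasureTheory.integral_neg] at hc
  have hne : ∀ s : ℝ, (s : ℂ) - T * I ≠ 0 := by
    intro s hh
    have := congrArg Complex.im hh
    simp at this
    linarith
  have hIntegr : MeasureTheory.Integrable (fun s : ℝ => ((RHsig N a b Mm i s : ℝ) : ℂ) / ((s : ℂ) - T * I)) := by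
    have hcont : Continuous (fun s : ℝ => ((s : ℂ) - T * I)⁻¹) :=
      Continuous.inv₀ (by fun_prop) hne
    have := MeasureTheory.Integrable.mul_bdd (c := T⁻¹) (hs.ofReal (𝕜 := ℂ))
      hcont.aestronglyMeasurable (Eventually.of_forall fun s => ?_)
    · exact this
    · rw [norm_inv]
      gcongr
      have := Complex.abs_im_le_norm ((s : ℂ) - T * I)
      simpa [abs_of_pos hT0] using this
  have him := congrArg Complex.im hc
  have h2 : ∫ s, (((RHsig N a b Mm i s : ℝ) : ℂ) / ((s : ℂ) - T * I)).im =
      (∫ s, ((RHsig N a b Mm i s : ℝ) : ℂ) / ((s : ℂ) - T * I)).im := by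
    exact (Complex.imCLM.integral_comp_comm hIntegr)
  have h3 : (∫ s, RHsig N a b Mm i s) * (1 / (2 * T)) ≤
      ∫ s, (((RHsig N a b Mm i s : ℝ) : ℂ) / ((s : ℂ) - T * I)).im := by
    rw [← MeasureTheory.integral_mul_const]
    refine MeasureTheory.integral_mono (hs.mul_const _) hIntegr.im ?_
    intro s
    have e : (((RHsig N a b Mm i s : ℝ) : ℂ) / ((s : ℂ) - T * I)).im
        = RHsig N a b Mm i s * (T / (s ^ 2 + T ^ 2)) := by
      rw [Complex.div_im]
      simp [Complex.normSq_apply]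
      ring
    show _ ≤ (((RHsig N a b Mm i s : ℝ) : ℂ) / ((s : ℂ) - T * I)).im
    rw [e]
    by_cases hm : s ∈ RHcut N a b
    · have hsS := hS hm
      gcongr ?_ * ?_
      · exact RHsig_nonneg i s
      · rw [div_le_div_iff₀ (by positivity) (by positivity)]
        nlinarith [hsS.1, hsS.2]
    · have : RHsig N a b Mm i s = 0 := Set.indicator_of_notMem hm _
      simp only [this, zero_mul, le_refl]
  rw [h2] at h3
  have h4 : |(∫ s, ((RHsig N a b Mm i s : ℝ) : ℂ) / ((s : ℂ) - T * I)).im| ≤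
      2 * Real.pi * (‖M (T * I) i 0‖ * ‖M (-(T * I)) i 1‖) := by
    refine (Complex.abs_im_le_norm _).trans ?_
    rw [← norm_neg, hc]
    simp [abs_of_pos Real.pi_pos]
  have h5 := (le_abs_self _).trans h4
  have h6 := h3.trans h5
  rw [mul_one_div, div_le_iff₀ (by positivity)] at h6
  linarith

end

end
open Complex Filter Topology Asymptotics Bornology
noncomputable section

theorem RHfract_exp (θ : ℝ) : Complex.exp (2 * Real.pi * I * (Int.fract θ : ℝ)) =
    Complex.exp ((2 * Real.pi * θ) * I) := by
  have : (2 * Real.pi * I * (Int.fract θ : ℝ) : ℂ) =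
      (2 * Real.pi * θ) * I - (⌊θ⌋ : ℂ) * (2 * Real.pi * I) := by
    rw [Int.fract]; push_cast; ring
  rw [this, Complex.exp_sub, Complex.exp_int_mul_two_pi_mul_I, div_one]

section
variable {N : ℕ} {a b β : ℕ → ℝ} {M : ℂ → Matrix (Fin 2) (Fin 2) ℂ}
    {Mp Mm : ℝ → Matrix (Fin 2) (Fin 2) ℂ}

theorem RHS.gauge_gen (hN : 1 ≤ N) (h : RHS N a b β M Mp Mm) (i j : Fin 2) (S : ℝ)
    (hS : RHcut N a b ⊆ Set.Icc (-S) S) (K C R : ℝ) (hK : 0 ≤ K) (hC : 0 ≤ C) (hR : 0 < R)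
    (E : ℂ → ℂ) (Ep Em : ℝ → ℂ) (hEd : DifferentiableOn ℂ E {z | z.im ≠ 0})
    (hEp : ∀ x : ℝ, Tendsto E (𝓝[{z | 0 < z.im}] (x : ℂ)) (𝓝 (Ep x)))
    (hEm : ∀ x : ℝ, Tendsto E (𝓝[{z | z.im < 0}] (x : ℂ)) (𝓝 (Em x)))
    (hEK : ∀ z : ℂ, z.im ≠ 0 → ‖E z‖ ≤ K)
    (hER : ∀ z : ℂ, z.im ≠ 0 → R ≤ ‖z‖ → ‖E z‖ ≤ C / ‖z‖)
    (hg : ∀ x ∉ RHP N a b, ∀ k, k + 1 < N → x ∈ Set.Ioo (b k) (a (k + 1)) →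
        Complex.exp (Ep x) * Mp x i j = Complex.exp (Em x) * Mm x i j)
    (ho : ∀ x : ℝ, x < a 0 ∨ b (N - 1) < x → Ep x - Em x = 0) (z : ℂ) (hz : z.im ≠ 0) :
    ‖M z i j‖ ≤ Real.exp K * (‖(1 : Matrix (Fin 2) (Fin 2) ℂ) i j‖ +
      2 * Real.exp K * (∫ s, RHrho N a b Mm i s) / |z.im|) := by
  set e := (1 : Matrix (Fin 2) (Fin 2) ℂ) i j with he
  have he1 : ‖e‖ ≤ 1 := by
    rw [he, Matrix.one_apply]; split_ifs <;> simp
  have hexp : ∀ w : ℂ, ‖w‖ ≤ K → ‖Complex.exp w‖ ≤ Real.exp K := fun w hw =>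
    (Complex.norm_exp_le_exp_norm w).trans (Real.exp_le_exp.mpr hw)
  have hEpK : ∀ x, ‖Ep x‖ ≤ K := fun x => by
    refine le_of_tendsto (hEp x).norm ?_
    filter_upwards [self_mem_nhdsWithin] with z hz
    exact hEK z (ne_of_gt hz)
  have hEmK : ∀ x, ‖Em x‖ ≤ K := fun x => by
    refine le_of_tendsto (hEm x).norm ?_
    filter_upwards [self_mem_nhdsWithin] with z hz
    exact hEK z (ne_of_lt hz)
  have hK1 : 1 ≤ Real.exp K := Real.one_le_exp hK
  have hB : RHBV (RHP N a b) (fun z => Complex.exp (E z) * M z i j - e)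
      (fun x => Complex.exp (Ep x) * Mp x i j - e) (fun x => Complex.exp (Em x) * Mm x i j - e) := by
    refine ⟨?_, ?_, ?_, ?_, ?_⟩
    · exact (hEd.cexp.mul (h.diff i j)).sub_const e
    · intro x hx
      exact (((Complex.continuous_exp.tendsto _).comp (hEp x)).mul (h.lp x hx i j)).sub_const e
    · intro x hx
      exact (((Complex.continuous_exp.tendsto _).comp (hEm x)).mul (h.lm x hx i j)).sub_const e
    · obtain ⟨B, hB0, hb⟩ := h.bd
      refine ⟨Real.exp K * (1 + B) + 1, fun z hz => ?_⟩
      have h1 := norm_sub_le (Complex.exp (E z) * M z i j) e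
      rw [norm_mul] at h1
      have hW := RHW_one_le (RHP N a b) z
      have h2 : ‖M z i j‖ ≤ (1 + B) * RHW (RHP N a b) z := by
        nlinarith [hb z hz i j, sq_nonneg (‖M z i j‖ - 1)]
      have h3 : ‖Complex.exp (E z)‖ * ‖M z i j‖ ≤ Real.exp K * ((1 + B) * RHW (RHP N a b) z) :=
        mul_le_mul (hexp _ (hEK z hz)) h2 (norm_nonneg _) (by positivity)
      nlinarith
    · obtain ⟨c, R', hc, hR', hi⟩ := h.inf
      refine ⟨Real.exp K * c + 2 * C, max (max R R') (C + 1), by positivity, fun z hz hzR => ?_⟩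
      have hz1 : R ≤ ‖z‖ := (le_max_left _ _).trans ((le_max_left _ _).trans hzR)
      have hz2 : R' ≤ ‖z‖ := (le_max_right _ _).trans ((le_max_left _ _).trans hzR)
      have hz3 : C + 1 ≤ ‖z‖ := (le_max_right _ _).trans hzR
      have hz0 : 0 < ‖z‖ := by linarith
      have hE1 := hER z hz hz1
      have hE2 : ‖E z‖ ≤ 1 := hE1.trans (by rw [div_le_one hz0]; linarith)
      have hE3 := Complex.norm_exp_sub_one_le hE2
      have ee : Complex.exp (E z) * M z i j - e =
        Complex.exp (E z) * (M z i j - e) + (Complex.exp (E z) - 1) * e := by ring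
      rw [ee]
      refine (norm_add_le _ _).trans ?_
      rw [norm_mul, norm_mul]
      have h1 : ‖Complex.exp (E z)‖ * ‖M z i j - e‖ ≤ Real.exp K * (c / ‖z‖) :=
        mul_le_mul (hexp _ (hEK z hz)) (hi z hz2 i j) (norm_nonneg _) (by positivity)
      have h2 : ‖Complex.exp (E z) - 1‖ * ‖e‖ ≤ (2 * (C / ‖z‖)) * 1 :=
        mul_le_mul (by linarith) he1 (norm_nonneg _) (by positivity)
      have e3 : (Real.exp K * c + 2 * C) / ‖z‖ = Real.exp K * (c / ‖z‖) + (2 * (C / ‖z‖)) * 1 := by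
        ring
      rw [e3]; linarith
  have hbd := hB.bound (fun s => (2 * Real.exp K) * RHrho N a b Mm i s)
    ((h.rho_int i S hS).const_mul _) ?_ z hz
  · rw [MeasureTheory.integral_const_mul] at hbd
    have e1 : M z i j = Complex.exp (-E z) * ((Complex.exp (E z) * M z i j - e) + e) := by
      rw [sub_add_cancel, ← mul_assoc, ← Complex.exp_add]; simp
    rw [e1, norm_mul]
    have h1 := norm_add_le (Complex.exp (E z) * M z i j - e) e
    have h2 : ‖Complex.exp (-E z)‖ ≤ Real.exp K := hexp _ (by rw [norm_neg]; exact hEK z hz)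
    refine mul_le_mul h2 ?_ (norm_nonneg _) (by positivity)
    linarith
  · filter_upwards [RHaux_ae (RHP N a b)] with x hx
    have hr0 := RHrho_nonneg (N := N) (a := a) (b := b) (Mm := Mm) i x
    rcases RHcls a b x N hN hx with ⟨k, hk, hh⟩ | ⟨k, hk, hh⟩ | hh
    · have hm : x ∈ RHcut N a b := (RHcut_mem N a b x).mpr ⟨k, hk, hh⟩
      have er : RHrho N a b Mm i x = ‖Mm x i 0‖ + ‖Mm x i 1‖ := Set.indicator_of_mem hm _
      have h1 : ‖Mm x i j‖ ≤ RHrho N a b Mm i x := by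
        rw [er]
        obtain rfl | rfl : j = 0 ∨ j = 1 := by omega
        · linarith [norm_nonneg (Mm x i 1)]
        · linarith [norm_nonneg (Mm x i 0)]
      have h2 : ‖Mp x i j‖ ≤ RHrho N a b Mm i x := by
        rw [er, h.cut x hx k hk hh]
        obtain rfl | rfl : j = 0 ∨ j = 1 := by omega
        · rw [RHmulJ0, norm_neg]; linarith [norm_nonneg (Mm x i 0)]
        · rw [RHmulJ1]; linarith [norm_nonneg (Mm x i 1)]
      rw [sub_sub_sub_cancel_right]
      refine (norm_sub_le _ _).trans ?_
      rw [norm_mul, norm_mul]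
      have h3 := mul_le_mul (hexp _ (hEpK x)) h2 (norm_nonneg _) (by positivity)
      have h4 := mul_le_mul (hexp _ (hEmK x)) h1 (norm_nonneg _) (by positivity)
      linarith
    · rw [hg x hx k hk hh, sub_self, norm_zero]; positivity
    · rw [h.out x hx hh, sub_eq_zero.mp (ho x hh), sub_self, norm_zero]; positivity

end

theorem RH_first_bound (N : ℕ) (hN : 1 ≤ N) (a b : ℕ → ℝ)
    (hab : ∀ k < N, a k < b k) (hba : ∀ k, k + 1 < N → b k < a (k + 1)) :
    ∃ C : ℝ, 0 ≤ C ∧ ∀ (β : ℕ → ℝ) (M : ℂ → Matrix (Fin 2) (Fin 2) ℂ)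
      (Mp Mm : ℝ → Matrix (Fin 2) (Fin 2) ℂ), RHS N a b β M Mp Mm →
      ∀ z : ℂ, z.im ≠ 0 → ∀ i j, ‖M z i j‖ ≤ C * (1 + 1 / |z.im|) := by
  obtain ⟨K, C, R, hK, hC, hR, hE⟩ := RHgauge N hN a b hab hba
  obtain ⟨S, hS0, hS⟩ : ∃ S : ℝ, 0 < S ∧ RHcut N a b ⊆ Set.Icc (-S) S := by
    refine ⟨1 + ∑ k ∈ Finset.range N, (|a k| + |b k|), ?_, ?_⟩
    · have : 0 ≤ ∑ k ∈ Finset.range N, (|a k| + |b k|) := Finset.sum_nonneg fun i _ => by positivity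
      linarith
    · intro x hx
      obtain ⟨k, hk, h⟩ := (RHcut_mem N a b x).mp hx
      have := Finset.single_le_sum (f := fun k => |a k| + |b k|) (s := Finset.range N)
        (fun i _ => by positivity) (Finset.mem_range.mpr hk)
      have h1 := neg_abs_le (a k)
      have h2 := le_abs_self (b k)
      constructor <;> linarith [h.1, h.2, abs_nonneg (a k), abs_nonneg (b k)]
  set D := Real.exp K with hD
  have hD1 : 1 ≤ D := Real.one_le_exp hK
  set A : ℝ := 16 * Real.pi * D ^ 4 with hA
  have hA0 : 0 < A := by positivity
  set V : ℝ := 8 * S * A with hV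
  refine ⟨D * (1 + 2 * D * V), by positivity, fun β M Mp Mm h => ?_⟩
  obtain ⟨E, Ep, Em, h1, h2, h3, h4, h5, h6, h7⟩ := hE β
  have hb : ∀ (z : ℂ), z.im ≠ 0 → ∀ i j, ‖M z i j‖ ≤
      D * (‖(1 : Matrix (Fin 2) (Fin 2) ℂ) i j‖ + 2 * D * (∫ s, RHrho N a b Mm i s) / |z.im|) := by
    intro z hz i j
    obtain rfl | rfl : j = 0 ∨ j = 1 := by omega
    · refine h.gauge_gen hN i 0 S hS K C R hK hC hR (fun z => -E z) (fun x => -Ep x)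
        (fun x => -Em x) h1.neg (fun x => (h2 x).neg) (fun x => (h3 x).neg)
        (by simpa using h4) (by simpa using h5) ?_ ?_ z hz
      · intro x hx k hk hh
        have e := h6 k hk x hh
        have e' : -Ep x = -Em x + 2 * Real.pi * I * (Int.fract (β k) : ℝ) := by
          linear_combination -e
        rw [h.gap x hx k hk hh, RHmulG0, e', Complex.exp_add, RHfract_exp]
        linear_combination (Complex.exp (-Em x) * Mm x i 0) * RHgexp (β k)
      · intro x hx
        linear_combination -h7 x hx
    · refine h.gauge_gen hN i 1 S hS K C R hK hC hR E Ep Em h1 h2 h3 h4 h5 ?_ h7 z hz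
      intro x hx k hk hh
      have e := h6 k hk x hh
      have e' : Em x = Ep x + 2 * Real.pi * I * (Int.fract (β k) : ℝ) := by
        linear_combination -e
      rw [h.gap x hx k hk hh, RHmulG1, e', Complex.exp_add, RHfract_exp]
      ring
  have hν : ∀ i, ∫ s, RHrho N a b Mm i s ≤ V := by
    intro i
    set ν := ∫ s, RHrho N a b Mm i s with hνd
    have hν0 : 0 ≤ ν := MeasureTheory.integral_nonneg fun s => RHrho_nonneg i s
    set T := max S V with hT
    have hT0 : 0 < T := hS0.trans_le (le_max_left _ _)
    have en := h.energy hN i S T hS0 hS (le_max_left _ _)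
    have nm := h.nu_mu i S hS0 hS
    rw [← hνd] at nm
    set μ := ∫ s, RHsig N a b Mm i s with hμ
    have b0 := hb (T * I) (by simpa using hT0.ne') i 0
    have b1 := hb (-(T * I)) (by simpa using hT0.ne') i 1
    rw [← hνd] at b0 b1
    have t0 : |((T : ℂ) * I).im| = T := by simp [abs_of_pos hT0]
    have t1 : |(-((T : ℂ) * I)).im| = T := by simp [abs_of_pos hT0]
    rw [t0] at b0
    rw [t1] at b1
    set q := 2 * D * ν / T with hq
    have hq0 : 0 ≤ q := by positivity
    have hprod : ‖M (T * I) i 0‖ * ‖M (-(T * I)) i 1‖ ≤ D ^ 2 * (q + q ^ 2) := by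
      refine (mul_le_mul b0 b1 (norm_nonneg _) (by positivity)).trans ?_
      obtain rfl | rfl : i = 0 ∨ i = 1 := by omega
      · simp
        nlinarith
      · simp
        nlinarith
    have hμ2 : μ ≤ A * (ν + ν ^ 2 / T) := by
      refine en.trans ((mul_le_mul_of_nonneg_left hprod (by positivity)).trans ?_)
      have e : 4 * Real.pi * T * (D ^ 2 * (q + q ^ 2)) =
          8 * Real.pi * D ^ 3 * ν + 16 * Real.pi * D ^ 4 * (ν ^ 2 / T) := by
        rw [hq]; field_simp; ring
      rw [e, hA, mul_add]
      have : 8 * Real.pi * D ^ 3 ≤ 16 * Real.pi * D ^ 4 := by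
        have : D ^ 3 ≤ D ^ 4 := pow_le_pow_right₀ hD1 (by norm_num)
        nlinarith [Real.pi_pos, pow_pos (zero_lt_one.trans_le hD1) 3]
      gcongr
    have h8 : ν ^ 2 ≤ 4 * S * A * ν + 4 * S * A * (ν ^ 2 / T) := by
      nlinarith [mul_le_mul_of_nonneg_left hμ2 (show 0 ≤ 4 * S by positivity)]
    have h9 : 4 * S * A * (ν ^ 2 / T) ≤ ν ^ 2 / 2 := by
      have : V ≤ T := le_max_right _ _
      rw [← mul_div_assoc, div_le_iff₀ hT0]
      nlinarith [sq_nonneg ν]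
    by_contra! hlt
    have hV0 : 0 < V := by positivity
    nlinarith [mul_pos (hV0.trans hlt) (sub_pos.mpr hlt)]
  intro z hz i j
  have hpos : 0 < |z.im| := abs_pos.mpr hz
  have he1 : ‖(1 : Matrix (Fin 2) (Fin 2) ℂ) i j‖ ≤ 1 := by
    rw [Matrix.one_apply]; split_ifs <;> simp
  refine (hb z hz i j).trans ?_
  have hD0 : 0 ≤ D := by linarith
  rw [mul_assoc D]
  refine mul_le_mul_of_nonneg_left ?_ hD0
  have : 2 * D * (∫ s, RHrho N a b Mm i s) / |z.im| ≤ 2 * D * V * (1 / |z.im|) := by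
    rw [mul_one_div]
    have := hν i
    gcongr
  have p1 : 0 ≤ 1 / |z.im| := by positivity
  have p2 : 0 ≤ 2 * D * V := by positivity
  nlinarith

end
open Complex Filter Topology Asymptotics Bornology
noncomputable section

theorem RHmorera (F : ℂ → ℂ) (U : Set ℂ) (hU : IsOpen U) (hc : ContinuousOn F U)
    (hd : ∀ z ∈ U, z.im ≠ 0 → DifferentiableAt ℂ F z) : DifferentiableOn ℂ F U := by
  rw [← Complex.isConservativeOn_and_continuousOn_iff_isDifferentiableOn hU]
  refine ⟨?_, hc⟩
  intro z w hzw
  rw [← add_eq_zero_iff_eq_neg, Complex.wedgeIntegral_add_wedgeIntegral_eq]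
  have hbase : ∀ z w : ℂ, Rectangle z w ⊆ U → (0 : ℝ) ∉ Set.Ioo (min z.im w.im) (max z.im w.im) →
      (∫ x : ℝ in z.re..w.re, F (x + z.im * I)) - (∫ x : ℝ in z.re..w.re, F (x + w.im * I)) +
      I • (∫ y : ℝ in z.im..w.im, F (re w + y * I)) -
      I • (∫ y : ℝ in z.im..w.im, F (re z + y * I)) = 0 := by
    intro z w hzw h0
    refine Complex.integral_boundary_rect_eq_zero_of_continuousOn_of_differentiableOn F z w
      (hc.mono hzw) ?_
    intro v hv
    refine (hd v (hzw ⟨?_, ?_⟩) ?_).differentiableWithinAt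
    · exact Set.Ioo_subset_Icc_self hv.1
    · exact Set.Ioo_subset_Icc_self hv.2
    · intro hv0
      have := hv.2
      rw [Set.mem_preimage, hv0] at this
      exact h0 this
  by_cases h0 : (0 : ℝ) ∈ Set.Ioo (min z.im w.im) (max z.im w.im)
  · have hmem : (0 : ℝ) ∈ Set.uIcc z.im w.im := Set.Ioo_subset_Icc_self h0
    have s1 : Rectangle z (w.re : ℂ) ⊆ U := by
      refine Set.Subset.trans ?_ hzw
      intro v hv
      refine ⟨by simpa using hv.1, ?_⟩
      have := hv.2
      rw [ofReal_im] at this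
      exact Set.uIcc_subset_uIcc_left hmem this
    have s2 : Rectangle (z.re : ℂ) w ⊆ U := by
      refine Set.Subset.trans ?_ hzw
      intro v hv
      refine ⟨by simpa using hv.1, ?_⟩
      have := hv.2
      rw [ofReal_im] at this
      exact Set.uIcc_subset_uIcc_right hmem this
    have e1 := hbase z (w.re : ℂ) s1 (by
      simp only [ofReal_im]; rintro ⟨h1, h2⟩
      rcases le_total z.im 0 with h | h
      · rw [max_eq_right h] at h2; exact lt_irrefl _ h2
      · rw [min_eq_right h] at h1; exact lt_irrefl _ h1)
    have e2 := hbase (z.re : ℂ) w s2 (by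
      simp only [ofReal_im]; rintro ⟨h1, h2⟩
      rcases le_total 0 w.im with h | h
      · rw [min_eq_left h] at h1; exact lt_irrefl _ h1
      · rw [max_eq_left h] at h2; exact lt_irrefl _ h2)
    simp only [ofReal_im, ofReal_re] at e1 e2
    have hv : ∀ x ∈ Set.uIcc z.re w.re, ContinuousOn (fun y : ℝ => F (x + y * I)) (Set.uIcc z.im w.im) := by
      intro x hx
      refine hc.comp (f := fun y : ℝ => (x : ℂ) + y * I) (by fun_prop) ?_
      intro y hy
      exact hzw ⟨by simpa using hx, by simpa using hy⟩
    have hadd : ∀ x ∈ Set.uIcc z.re w.re, (∫ y : ℝ in z.im..w.im, F (x + y * I)) =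
        (∫ y : ℝ in z.im..0, F (x + y * I)) + ∫ y : ℝ in (0:ℝ)..w.im, F (x + y * I) := by
      intro x hx
      refine (intervalIntegral.integral_add_adjacent_intervals ?_ ?_).symm
      · exact ((hv x hx).mono (Set.uIcc_subset_uIcc_left hmem)).intervalIntegrable
      · exact ((hv x hx).mono (Set.uIcc_subset_uIcc_right hmem)).intervalIntegrable
    rw [hadd w.re Set.right_mem_uIcc, hadd z.re Set.left_mem_uIcc]
    simp only [smul_eq_mul] at e1 e2 ⊢
    linear_combination e1 + e2
  · exact hbase z w hzw h0

theorem RHlocal (f g : ℂ → ℂ) (hf : DifferentiableOn ℂ f {z | z.im ≠ 0})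
    (hg : DifferentiableOn ℂ g {z | z.im ≠ 0}) (x r : ℝ) (hr : 0 < r)
    (hl : ∀ y : ℝ, |y - x| < r → ∃ l, Tendsto f (𝓝[{z | 0 < z.im}] (y : ℂ)) (𝓝 l) ∧
      Tendsto g (𝓝[{z | z.im < 0}] (y : ℂ)) (𝓝 l)) (B : ℝ) (hB : 0 ≤ B)
    (hfB : ∀ z : ℂ, 0 < z.im → ‖f z‖ ≤ B * (1 + 1 / |z.im|))
    (hgB : ∀ z : ℂ, z.im < 0 → ‖g z‖ ≤ B * (1 + 1 / |z.im|)) (z : ℂ) (hz : ‖z - x‖ ≤ r / 4) :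
    (0 < z.im → ‖f z‖ ≤ 8 * B * (r + 1) / r) ∧ (z.im < 0 → ‖g z‖ ≤ 8 * B * (r + 1) / r) := by
  classical
  set φ : ℂ → ℂ := fun z => if 0 < z.im then f z else g z with hφ
  set A : Set ℂ := {z | z.im ≠ 0} with hA
  have hAu : A = {z : ℂ | 0 < z.im} ∪ {z : ℂ | z.im < 0} := by
    ext z
    simp only [hA, Set.mem_union]
    constructor
    · intro h; rcases lt_or_gt_of_ne h with h | h
      · exact Or.inr h
      · exact Or.inl h
    · rintro (h | h)
      · exact ne_of_gt h
      · exact ne_of_lt h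
  have hup : IsOpen {z : ℂ | 0 < z.im} := isOpen_lt continuous_const Complex.continuous_im
  have hdn : IsOpen {z : ℂ | z.im < 0} := isOpen_lt Complex.continuous_im continuous_const
  have hφu : ∀ z : ℂ, 0 < z.im → φ =ᶠ[𝓝 z] f := by
    intro z hz
    filter_upwards [hup.mem_nhds hz] with w hw
    exact if_pos hw
  have hφd : ∀ z : ℂ, z.im < 0 → φ =ᶠ[𝓝 z] g := by
    intro z hz
    filter_upwards [hdn.mem_nhds hz] with w hw
    exact if_neg (not_lt.mpr (le_of_lt hw))
  have hφdiff : ∀ z ∈ A, DifferentiableAt ℂ φ z := by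
    intro z hz
    rcases lt_or_gt_of_ne hz with h | h
    · exact (hg.differentiableAt (RHaux_isOpen_im_ne.mem_nhds hz)).congr_of_eventuallyEq (hφd z h)
    · exact (hf.differentiableAt (RHaux_isOpen_im_ne.mem_nhds hz)).congr_of_eventuallyEq (hφu z h)
  set F := extendFrom A φ with hF
  have hFA : ∀ z ∈ A, F z = φ z := by
    intro z hz
    refine extendFrom_eq (subset_closure hz) ?_
    exact (hφdiff z hz).continuousAt.tendsto.mono_left nhdsWithin_le_nhds
  have hcl : Metric.ball (x : ℂ) r ⊆ closure A := by
    intro z _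
    by_cases hz : z.im = 0
    · have : z ∈ closure {z : ℂ | 0 < z.im} := by
        rw [Complex.closure_setOfPred_lt_im]; exact hz.ge
      exact closure_mono (fun w hw => ne_of_gt hw) this
    · exact subset_closure hz
  have hFc : ContinuousOn F (Metric.ball (x : ℂ) r) := by
    refine continuousOn_extendFrom hcl ?_
    intro z hz
    by_cases hz0 : z.im = 0
    · obtain ⟨y, rfl⟩ : ∃ y : ℝ, (y : ℂ) = z := ⟨z.re, by apply Complex.ext <;> simp [hz0]⟩
      rw [Metric.mem_ball, dist_eq_norm, ← ofReal_sub, Complex.norm_real, Real.norm_eq_abs] at hz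
      obtain ⟨l, h1, h2⟩ := hl y hz
      refine ⟨l, ?_⟩
      rw [hAu, nhdsWithin_union]
      refine Tendsto.sup ?_ ?_
      · refine h1.congr' ?_
        filter_upwards [self_mem_nhdsWithin] with w hw
        exact (if_pos hw).symm
      · refine h2.congr' ?_
        filter_upwards [self_mem_nhdsWithin] with w hw
        exact (if_neg (not_lt.mpr (le_of_lt hw))).symm
    · exact ⟨φ z, (hφdiff z hz0).continuousAt.tendsto.mono_left nhdsWithin_le_nhds⟩
  have hFd : DifferentiableOn ℂ F (Metric.ball (x : ℂ) r) := by
    refine RHmorera F _ Metric.isOpen_ball hFc ?_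
    intro z _ hz0
    refine (hφdiff z hz0).congr_of_eventuallyEq ?_
    filter_upwards [RHaux_isOpen_im_ne.mem_nhds hz0] with w hw
    exact hFA w hw
  have hFB : ∀ z : ℂ, z.im ≠ 0 → ‖F z‖ ≤ B * (1 + 1 / |z.im|) := by
    intro z hz0
    rw [hFA z hz0]
    rcases lt_or_gt_of_ne hz0 with h | h
    · rw [hφ]; simp only [if_neg (not_lt.mpr h.le)]; exact hgB z h
    · rw [hφ]; simp only [if_pos h]; exact hfB z h
  set ρ := r / 2 with hρ
  have hρ0 : 0 < ρ := by positivity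
  set H : ℂ → ℂ := fun z => F z * ((z - x) ^ 2 - (ρ : ℂ) ^ 2) with hH
  have hsub : Metric.closedBall (x : ℂ) ρ ⊆ Metric.ball (x : ℂ) r :=
    Metric.closedBall_subset_ball (by rw [hρ]; linarith)
  have hHd : DiffContOnCl ℂ H (Metric.ball (x : ℂ) ρ) := by
    refine DifferentiableOn.diffContOnCl ?_
    rw [closure_ball _ hρ0.ne']
    exact (hFd.mono hsub).mul (by fun_prop)
  have hmax : ‖H z‖ ≤ 2 * ρ * B * (r + 1) := by
    refine Complex.norm_le_of_forall_mem_frontier_norm_le Metric.isBounded_ball hHd ?_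
      (z := z) ?_
    · intro w hw
      rw [frontier_ball _ hρ0.ne', mem_sphere_iff_norm] at hw
      -- on the sphere
      have hre : (w.re - x) ^ 2 + w.im ^ 2 = ρ ^ 2 := by
        rw [← hw, Complex.sq_norm, Complex.normSq_apply]
        simp; ring
      have himr : |w.im| ≤ r := by
        have := Complex.abs_im_le_norm (w - x)
        simp at this
        rw [hw] at this; linarith
      have e1 : (w - x) ^ 2 - (ρ : ℂ) ^ 2 = 2 * I * w.im * (w - x) := by
        have hre' : (((w.re - x) ^ 2 + w.im ^ 2 : ℝ) : ℂ) = ((ρ ^ 2 : ℝ) : ℂ) := by rw [hre]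
        push_cast at hre'
        have ew : w = w.re + w.im * I := (Complex.re_add_im w).symm
        rw [← hre']
        have : w - x = (w.re - x) + w.im * I := by
          nth_rewrite 1 [ew]; ring
        rw [this]
        linear_combination (-(w.im : ℂ) ^ 2) * Complex.I_sq
      have e2 : ‖(w - x) ^ 2 - (ρ : ℂ) ^ 2‖ = 2 * |w.im| * ρ := by
        rw [e1, norm_mul, norm_mul, norm_mul, hw, Complex.norm_real]
        simp
      simp only [hH]
      rw [norm_mul, e2]
      by_cases hw0 : w.im = 0
      · rw [hw0]; simp; positivity
      · have hb := hFB w hw0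
        have hp : 0 < |w.im| := abs_pos.mpr hw0
        calc ‖F w‖ * (2 * |w.im| * ρ) ≤ (B * (1 + 1 / |w.im|)) * (2 * |w.im| * ρ) := by gcongr
          _ = 2 * ρ * B * (|w.im| + 1) := by field_simp
          _ ≤ _ := by gcongr
    · rw [closure_ball _ hρ0.ne', mem_closedBall_iff_norm]
      rw [hρ]; linarith
  have hlow : r ^ 2 * (3 / 16) ≤ ‖(z - x) ^ 2 - (ρ : ℂ) ^ 2‖ := by
    have h1 := norm_sub_norm_le ((ρ : ℂ) ^ 2) ((z - x) ^ 2)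
    rw [norm_sub_rev, norm_pow, norm_pow, Complex.norm_real, Real.norm_of_nonneg hρ0.le] at h1
    have h2 : ‖z - x‖ ^ 2 ≤ (r / 4) ^ 2 := by gcongr
    rw [hρ] at h1
    rw [hρ]
    nlinarith
  have hfin : ‖F z‖ ≤ 8 * B * (r + 1) / r := by
    simp only [hH] at hmax
    rw [norm_mul] at hmax
    have h1 : ‖F z‖ * (r ^ 2 * (3 / 16)) ≤ 2 * ρ * B * (r + 1) :=
      (mul_le_mul_of_nonneg_left hlow (norm_nonneg _)).trans hmax
    rw [hρ] at h1
    have h3 : ‖F z‖ * r * (3 / 16) ≤ B * (r + 1) := by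
      by_contra! hlt
      nlinarith
    rw [le_div_iff₀ hr]
    have : 0 ≤ B * (r + 1) := by positivity
    linarith
  constructor
  · intro h
    have : F z = f z := by rw [hFA z (ne_of_gt h)]; exact if_pos h
    rwa [← this]
  · intro h
    have : F z = g z := by rw [hFA z (ne_of_lt h)]; exact if_neg (not_lt.mpr h.le)
    rwa [← this]

end
open Complex Filter Topology Asymptotics Bornology
noncomputable section

theorem RHnear (N : ℕ) (hN : 1 ≤ N) (a b β : ℕ → ℝ) (M : ℂ → Matrix (Fin 2) (Fin 2) ℂ)
    (Mp Mm : ℝ → Matrix (Fin 2) (Fin 2) ℂ) (h : RHS N a b β M Mp Mm) (x r : ℝ) (hr : 0 < r)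
    (hx : ∀ k < N, r ≤ |x - a k| ∧ r ≤ |x - b k|) :
    ∃ (u : Fin 2 → ℂ) (σ : Fin 2 → Fin 2), (∀ j, σ (σ j) = j) ∧ (∀ j, ‖u j‖ = 1) ∧
      ∀ y : ℝ, |y - x| < r → y ∉ RHP N a b ∧ ∀ i j, Mp y i j = u j * Mm y i (σ j) := by
  have hP : ∀ y : ℝ, |y - x| < r → y ∉ RHP N a b := by
    intro y hy hm
    obtain ⟨k, hk, rfl | rfl⟩ := (RHP_mem N a b y).mp hm
    · have := (hx k hk).1; rw [abs_sub_comm] at hy; linarith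
    · have := (hx k hk).2; rw [abs_sub_comm] at hy; linarith
  have key1 : ∀ p y : ℝ, r ≤ |x - p| → |y - x| < r → p < x → p < y := by
    intro p y h1 h2 h3
    rw [abs_of_pos (by linarith)] at h1
    have := (abs_lt.mp h2).1
    linarith
  have key2 : ∀ p y : ℝ, r ≤ |x - p| → |y - x| < r → x < p → y < p := by
    intro p y h1 h2 h3
    rw [abs_of_neg (by linarith)] at h1
    have := (abs_lt.mp h2).2
    linarith
  have hx0 : x ∉ RHP N a b := hP x (by simpa using hr)
  rcases RHcls a b x N hN hx0 with ⟨k, hk, hh⟩ | ⟨k, hk, hh⟩ | hh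
  · refine ⟨![-1, 1], ![1, 0], ?_, ?_, ?_⟩
    · intro j; fin_cases j <;> rfl
    · intro j; fin_cases j <;> simp
    · intro y hy
      refine ⟨hP y hy, fun i j => ?_⟩
      rw [h.cut y (hP y hy) k hk ⟨key1 _ _ (hx k hk).1 hy hh.1, key2 _ _ (hx k hk).2 hy hh.2⟩]
      fin_cases j
      · have := RHmulJ0 (Mm y) i
        simpa using this
      · have := RHmulJ1 (Mm y) i
        simpa using this
  · refine ⟨![Complex.exp (-(2 * Real.pi * β k) * Complex.I),
      Complex.exp ((2 * Real.pi * β k) * Complex.I)], id, ?_, ?_, ?_⟩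
    · intro j; rfl
    · intro j
      fin_cases j
      · have := Complex.norm_exp_ofReal_mul_I (-(2 * Real.pi * β k))
        push_cast at this
        simpa using this
      · have := Complex.norm_exp_ofReal_mul_I (2 * Real.pi * β k)
        push_cast at this
        simpa using this
    · intro y hy
      refine ⟨hP y hy, fun i j => ?_⟩
      rw [h.gap y (hP y hy) k hk ⟨key1 _ _ (hx k (by omega)).2 hy hh.1,
        key2 _ _ (hx (k + 1) hk).1 hy hh.2⟩]
      fin_cases j
      · have := RHmulG0 (Mm y) (β k) i
        rw [mul_comm] at this
        exact this.trans (mul_comm _ _) |>.trans (by simp [mul_comm])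
      · have := RHmulG1 (Mm y) (β k) i
        exact this.trans (by simp [mul_comm])
  · refine ⟨fun _ => 1, id, fun _ => rfl, fun _ => by simp, ?_⟩
    intro y hy
    refine ⟨hP y hy, fun i j => ?_⟩
    rw [h.out y (hP y hy)]
    · simp
    · rcases hh with hh | hh
      · exact Or.inl (key2 _ _ (hx 0 (by omega)).1 hy hh)
      · exact Or.inr (key1 _ _ (hx (N - 1) (by omega)).2 hy hh)

theorem RHoff (N : ℕ) (hN : 1 ≤ N) (a b : ℕ → ℝ)
    (hab : ∀ k < N, a k < b k) (hba : ∀ k, k + 1 < N → b k < a (k + 1)) (ε : ℝ) (hε : 0 < ε) :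
    ∃ C : ℝ, 0 ≤ C ∧ ∀ (β : ℕ → ℝ) (M : ℂ → Matrix (Fin 2) (Fin 2) ℂ)
      (Mp Mm : ℝ → Matrix (Fin 2) (Fin 2) ℂ), RHS N a b β M Mp Mm →
      ∀ z : ℂ, z.im ≠ 0 → (∀ j < N, ε ≤ ‖z - (a j : ℂ)‖ ∧ ε ≤ ‖z - (b j : ℂ)‖) →
      ∀ i j, ‖M z i j‖ ≤ C := by
  obtain ⟨B, hB, hM⟩ := RH_first_bound N hN a b hab hba
  set r := ε / 2 with hrd
  have hr : 0 < r := by positivity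
  refine ⟨B * (1 + 4 / r) + 8 * B * (r + 1) / r, by positivity, ?_⟩
  intro β M Mp Mm h z hz hd i j
  have hpos1 : 0 ≤ B * (1 + 4 / r) := by positivity
  have hpos2 : 0 ≤ 8 * B * (r + 1) / r := by positivity
  have hM' := hM β M Mp Mm h
  rcases le_total (r / 4) |z.im| with hc | hc
  · have h1 : 1 / |z.im| ≤ 4 / r := by
      have := one_div_le_one_div_of_le (by positivity) hc
      have h2 : 1 / (r / 4) = 4 / r := by field_simp
      linarith
    have h3 := hM' z hz i j
    have h4 : B * (1 + 1 / |z.im|) ≤ B * (1 + 4 / r) := by gcongr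
    linarith
  · have hn : ‖z - (z.re : ℂ)‖ = |z.im| := by
      have : z - (z.re : ℂ) = (z.im : ℂ) * I := by
        apply Complex.ext <;> simp
      rw [this]; simp
    have hdist : ∀ p : ℝ, ε ≤ ‖z - (p : ℂ)‖ → r ≤ |z.re - p| := by
      intro p hp
      have h1 : ‖z - (p : ℂ)‖ ≤ ‖z - (z.re : ℂ)‖ + ‖(z.re : ℂ) - p‖ :=
        norm_sub_le_norm_sub_add_norm_sub _ _ _
      have h2 : ‖(z.re : ℂ) - p‖ = |z.re - p| := by
        rw [← Complex.ofReal_sub, Complex.norm_real, Real.norm_eq_abs]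
      rw [hn, h2] at h1
      linarith
    obtain ⟨u, σ, hσ, hu, hy⟩ := RHnear N hN a b β M Mp Mm h z.re r hr
      (fun k hk => ⟨hdist _ (hd k hk).1, hdist _ (hd k hk).2⟩)
    have main : ∀ j, (0 < z.im → ‖M z i j‖ ≤ 8 * B * (r + 1) / r) ∧
        (z.im < 0 → ‖u j * M z i (σ j)‖ ≤ 8 * B * (r + 1) / r) := by
      intro j
      refine RHlocal (fun z => M z i j) (fun z => u j * M z i (σ j)) (h.diff i j)
        ((h.diff i (σ j)).const_mul _) z.re r hr ?_ B hB ?_ ?_ z (by rw [hn]; exact hc)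
      · intro y hyy
        obtain ⟨h1, h2⟩ := hy y hyy
        refine ⟨Mp y i j, h.lp y h1 i j, ?_⟩
        rw [h2]
        exact (h.lm y h1 i (σ j)).const_mul _
      · intro w hw
        exact hM' w hw.ne' i j
      · intro w hw
        rw [norm_mul, hu, one_mul]
        exact hM' w hw.ne i _
    rcases lt_or_gt_of_ne hz with hz | hz
    · have := (main (σ j)).2 hz
      rw [norm_mul, hu, one_mul, hσ] at this
      linarith
    · have := (main j).1 hz
      linarith

theorem RHall (N : ℕ) (hN : 1 ≤ N) (a b : ℕ → ℝ)
    (hab : ∀ k < N, a k < b k) (hba : ∀ k, k + 1 < N → b k < a (k + 1)) (ε : ℝ) (hε : 0 < ε) :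
    ∃ C : ℝ, 0 < C ∧ ∀ (β : ℕ → ℝ) (M : ℂ → Matrix (Fin 2) (Fin 2) ℂ),
      IsModelRHSolution N a b β M →
      ∀ z ∈ (cutSet N a b)ᶜ, (∀ j < N, ε ≤ ‖z - (a j : ℂ)‖ ∧ ε ≤ ‖z - (b j : ℂ)‖) →
      (∀ i j, ‖M z i j‖ ≤ C) ∧ M z 0 0 * M z 1 1 - M z 0 1 * M z 1 0 = 1 := by
  obtain ⟨C, hC, hM⟩ := RHoff N hN a b hab hba (ε / 2) (by positivity)
  refine ⟨C + 1, by positivity, ?_⟩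
  intro β M hS z hz hd
  obtain ⟨Mp, Mm, h⟩ := RHS_mk N hN a b β M hS
  by_cases hi : z.im = 0
  · have hzr : z = ((z.re : ℝ) : ℂ) := by apply Complex.ext <;> simp [hi]
    have hcont : ∀ i j, Tendsto (fun w => M w i j) (𝓝[{w : ℂ | 0 < w.im}] z) (𝓝 (M z i j)) :=
      fun i j => ((hS.1 i j z hz).continuousAt).tendsto.mono_left nhdsWithin_le_nhds
    have hne : NeBot (𝓝[{w : ℂ | 0 < w.im}] z) := by
      rw [hzr]; exact RHneBot_up _
    constructor
    · intro i j
      refine le_of_tendsto (hcont i j).norm ?_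
      have hball : Metric.ball z (ε / 2) ∈ 𝓝[{w : ℂ | 0 < w.im}] z :=
        nhdsWithin_le_nhds (Metric.ball_mem_nhds z (by positivity))
      filter_upwards [hball, self_mem_nhdsWithin] with w hw hw2
      have hw2' : 0 < w.im := hw2
      have hdd : ∀ p : ℂ, ε ≤ ‖z - p‖ → ε / 2 ≤ ‖w - p‖ := by
        intro p hp
        have h1 : ‖z - p‖ ≤ ‖z - w‖ + ‖w - p‖ := norm_sub_le_norm_sub_add_norm_sub _ _ _
        have h2 : ‖w - z‖ < ε / 2 := by simpa [dist_eq_norm] using hw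
        rw [norm_sub_rev] at h2
        linarith
      have := hM β M Mp Mm h w hw2'.ne' (fun k hk => ⟨hdd _ (hd k hk).1, hdd _ (hd k hk).2⟩) i j
      linarith
    · have h1 := ((hcont 0 0).mul (hcont 1 1)).sub ((hcont 0 1).mul (hcont 1 0))
      refine tendsto_nhds_unique h1 (Tendsto.congr' ?_ tendsto_const_nhds)
      filter_upwards [self_mem_nhdsWithin] with w hw
      have hw2' : 0 < w.im := hw
      exact (h.det_one hN w hw2'.ne').symm
  · refine ⟨fun i j => ?_, h.det_one hN z hi⟩
    have := hM β M Mp Mm h z hi (fun k hk => ⟨by linarith [(hd k hk).1], by linarith [(hd k hk).2]⟩) i j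
    linarith

end
/-- For every `ε > 0` there is a constant `C > 0` such that for every
vector of parameters `(β₁, …, β_{N-1}) ∈ ℝ^{N-1}` and every solution `M` of the
model Riemann-Hilbert problem with parameters `β`, both `M(z)` and `M(z)⁻¹` are
bounded by `C` (entrywise) at every point `z ∈ ℂ \ [a₁, b_N]` with
`|z - aⱼ| ≥ ε` and `|z - bⱼ| ≥ ε` for all `j = 1, …, N`.  (In particular, taking
`βₖ = n αₖ`, the solutions of the model Riemann-Hilbert problem and their inverses
are bounded on this set uniformly in the integer `n`.) -/
theorem model_RH_uniform_bound (N : ℕ) (hN : 1 ≤ N) (a b : ℕ → ℝ)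
    (hab : ∀ k < N, a k < b k) (hba : ∀ k, k + 1 < N → b k < a (k + 1)) :
    ∀ ε > (0 : ℝ), ∃ C > (0 : ℝ), ∀ β : ℕ → ℝ, ∀ M : ℂ → Matrix (Fin 2) (Fin 2) ℂ,
      IsModelRHSolution N a b β M →
      ∀ z ∈ (cutSet N a b)ᶜ,
        (∀ j < N, ε ≤ ‖z - (a j : ℂ)‖ ∧ ε ≤ ‖z - (b j : ℂ)‖) →
        (∀ i j, ‖M z i j‖ ≤ C) ∧ (∀ i j, ‖(M z)⁻¹ i j‖ ≤ C) := by
  intro ε hε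
  obtain ⟨C, hC, hM⟩ := RHall N hN a b hab hba ε hε
  refine ⟨C, hC, ?_⟩
  intro β M hS z hz hd
  obtain ⟨h1, h2⟩ := hM β M hS z hz hd
  refine ⟨h1, ?_⟩
  have hinv : (M z)⁻¹ = !![M z 1 1, -M z 0 1; -M z 1 0, M z 0 0] := by
    rw [Matrix.inv_def, Matrix.det_fin_two, h2, Matrix.adjugate_fin_two]
    simp
  rw [hinv]
  intro i j
  fin_cases i <;> fin_cases j <;> simpa using h1 _ _
end
end
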